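/- Let T_l ↘ −∞ and for each l let u_l be a mild solution of the Navier–Stokes equations on ℝⁿ×(T_l,0) with some initial datum in L^∞(ℝⁿ;ℝⁿ), such that |u_l| ≤ C on ℝⁿ×(T_l,0) with C independent of l. Then there is a subsequence of (u_l) converging locally uniformly in ℝⁿ×(−∞,0) to an ancient mild solution u of the Navier–Stokes equations with |u| ≤ C in ℝⁿ×(−∞,0). -/

import Mathlib

open MeasureTheory Real Filter Topology

noncomputable section

/-- Euclidean space ℝⁿ. -/
abbrev Euc (n : ℕ) := EuclideanSpace ℝ (Fin n)

/-- The heat kernel Γ(x,t) = (4πt)^{-n/2} exp(-|x|²/(4t)). -/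
noncomputable def heatKer (n : ℕ) (x : Euc n) (t : ℝ) : ℝ :=
  (4 * π * t) ^ (-(n : ℝ) / 2) * Real.exp (-‖x‖ ^ 2 / (4 * t))

/-- The fundamental solution G of the Laplacian on ℝⁿ (n ≥ 2). -/
noncomputable def lapFund (n : ℕ) (x : Euc n) : ℝ :=
  if n = 2 then (2 * π)⁻¹ * Real.log ‖x‖
  else -((((n : ℝ) - 2) * (2 * π ^ ((n : ℝ) / 2) / Real.Gamma ((n : ℝ) / 2)))⁻¹) *
      ‖x‖ ^ (2 - (n : ℝ))

/-- The generating function Φ(x,t) = ∫_{ℝⁿ} G(y) Γ(x-y,t) dy. -/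
noncomputable def genPhi (n : ℕ) (x : Euc n) (t : ℝ) : ℝ :=
  ∫ y : Euc n, lapFund n y * heatKer n (x - y) t

/-- Spatial partial derivative ∂f/∂x_i of a scalar function on ℝⁿ. -/
noncomputable def pd (n : ℕ) (i : Fin n) (f : Euc n → ℝ) (x : Euc n) : ℝ :=
  fderiv ℝ f x (EuclideanSpace.single i 1)

/-- The Laplacian of a scalar function on ℝⁿ. -/
noncomputable def lap (n : ℕ) (f : Euc n → ℝ) (x : Euc n) : ℝ :=
  ∑ i : Fin n, pd n i (pd n i f) x

/-- The Oseen kernel K_{ij} = (-δ_{ij}Δ + ∂²/∂x_i∂x_j)Φ. -/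
noncomputable def Kmat (n : ℕ) (i j : Fin n) (x : Euc n) (t : ℝ) : ℝ :=
  (if i = j then -(lap n (fun y => genPhi n y t) x) else 0)
    + pd n i (pd n j (fun y => genPhi n y t)) x

/-- The kernel K_{ijk} = ∂K_{ij}/∂x_k. -/
noncomputable def Kten (n : ℕ) (i j k : Fin n) (x : Euc n) (t : ℝ) : ℝ :=
  pd n k (fun y => Kmat n i j y t) x

/-- Mild solution of the Navier–Stokes equations on ℝⁿ × (t₀,t₁) with initial datum u₀:
u_i(x,t) = ∫ Γ(x-y,t-t₀) u₀ᵢ(y) dy - ∫_{t₀}^t ∫ K_{ijk}(x-y,t-s) u_k u_j dy ds. -/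
def IsMildNS (n : ℕ) (t₀ t₁ : ℝ) (u₀ : Euc n → Euc n) (u : Euc n → ℝ → Euc n) : Prop :=
  ∀ x : Euc n, ∀ t : ℝ, t ∈ Set.Ioo t₀ t₁ → ∀ i : Fin n,
    u x t i = (∫ y : Euc n, heatKer n (x - y) (t - t₀) * u₀ y i)
      - ∫ s in Set.Ioo t₀ t, ∫ y : Euc n,
          ∑ j : Fin n, ∑ k : Fin n, Kten n i j k (x - y) (t - s) * u y s k * u y s j

/-- Spatial partial derivative for functions on space-time ℝⁿ × ℝ. -/
noncomputable def pdx (n : ℕ) (i : Fin n) (g : Euc n × ℝ → ℝ) (p : Euc n × ℝ) : ℝ :=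
  fderiv ℝ g p (EuclideanSpace.single i 1, 0)

/-- Time derivative for functions on space-time ℝⁿ × ℝ. -/
noncomputable def pdt (n : ℕ) (g : Euc n × ℝ → ℝ) (p : Euc n × ℝ) : ℝ :=
  fderiv ℝ g p (0, 1)

/-- Spatial Laplacian for functions on space-time ℝⁿ × ℝ. -/
noncomputable def lapx (n : ℕ) (g : Euc n × ℝ → ℝ) (p : Euc n × ℝ) : ℝ :=
  ∑ i : Fin n, pdx n i (pdx n i g) p

/-- An ancient mild solution of the Navier–Stokes equations: a bounded measurable
u : ℝⁿ × (-∞,0) → ℝⁿ for which there is a sequence T_l → -∞ such that u restricted to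
ℝⁿ × (T_l,0) is a mild solution with initial datum u(·,T_l). -/
def IsAncientMild (n : ℕ) (u : Euc n → ℝ → Euc n) : Prop :=
  Measurable (fun q : Euc n × ℝ => u q.1 q.2) ∧
  (∃ C : ℝ, ∀ x : Euc n, ∀ t < (0:ℝ), ‖u x t‖ ≤ C) ∧
  ∃ S : ℕ → ℝ, Filter.Tendsto S Filter.atTop Filter.atBot ∧
    ∀ l, S l < 0 ∧ IsMildNS n (S l) 0 (fun x => u x (S l)) u

/-- The linear form with prescribed coefficients. -/
def coordForm {n : ℕ} (g : Fin n → ℝ) : Euc n →L[ℝ] ℝ :=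
  ∑ i, g i • (EuclideanSpace.proj i : Euc n →L[ℝ] ℝ)

lemma coordForm_apply {n : ℕ} (g : Fin n → ℝ) (x : Euc n) : coordForm g x = ∑ i, g i * x i := by
  simp [coordForm]

lemma coordForm_single {n : ℕ} (g : Fin n → ℝ) (i : Fin n) :
    coordForm g (EuclideanSpace.single i 1) = g i := by
  simp [coordForm_apply]

lemma eq_coordForm {n : ℕ} {L : Euc n →L[ℝ] ℝ} {g : Fin n → ℝ}
    (h : ∀ i, L (EuclideanSpace.single i 1) = g i) : L = coordForm g := by
  refine ContinuousLinearMap.coe_injective ?_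
  refine (EuclideanSpace.basisFun (Fin n) ℝ).toBasis.ext fun i => ?_
  simp [coordForm_single, h]

lemma norm_coordForm_le {n : ℕ} (g : Fin n → ℝ) : ‖coordForm g‖ ≤ ∑ i, |g i| := by
  refine ContinuousLinearMap.opNorm_le_bound _ (Finset.sum_nonneg fun i _ => abs_nonneg _) ?_
  intro x
  rw [coordForm_apply, Finset.sum_mul]
  refine (norm_sum_le _ _).trans (Finset.sum_le_sum fun i _ => ?_)
  rw [norm_mul]
  exact mul_le_mul_of_nonneg_left (PiLp.norm_apply_le x i) (abs_nonneg _)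

lemma HasFDerivAt.pd_coordForm {n : ℕ} {f : Euc n → ℝ} {g : Fin n → ℝ} {x : Euc n}
    (h : HasFDerivAt f (coordForm g) x) (i : Fin n) : pd n i f x = g i := by
  rw [pd, h.fderiv, coordForm_single]

lemma abs_coord_le {n : ℕ} (x : Euc n) (i : Fin n) : |x i| ≤ ‖x‖ := PiLp.norm_apply_le x i

/-- Differentiation under the integral sign with a globally bounded gradient. -/
lemma hasFDerivAt_integral_coordForm {n : ℕ} {α : Type*} [MeasurableSpace α] {μ : Measure α}
    {F : Euc n → α → ℝ} {G : Fin n → Euc n → α → ℝ} {b : α → ℝ}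
    (hF : ∀ x, Integrable (F x) μ) (hG : ∀ i x, AEStronglyMeasurable (G i x) μ)
    (hb : Integrable b μ) (hGb : ∀ᵐ a ∂μ, ∀ i x, |G i x a| ≤ b a)
    (hd : ∀ᵐ a ∂μ, ∀ x, HasFDerivAt (F · a) (coordForm fun i => G i x a) x) (x : Euc n) :
    HasFDerivAt (fun x => ∫ a, F x a ∂μ) (coordForm fun i => ∫ a, G i x a ∂μ) x := by
  have hGi : ∀ i, Integrable (G i x) μ := fun i =>
    hb.mono' (hG i x) (hGb.mono fun a h => h i x)
  have key := hasFDerivAt_integral_of_dominated_of_fderiv_le (μ := μ) (𝕜 := ℝ) (F := F)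
    (F' := fun x a => coordForm fun i => G i x a) (x₀ := x) (s := Set.univ)
    (bound := fun a => n * b a) univ_mem
    (Eventually.of_forall fun x => (hF x).aestronglyMeasurable) (hF x)
    (by
      simp only [coordForm]
      exact Finset.aestronglyMeasurable_fun_sum _ fun i _ => (hG i x).smul_const _)
    (hGb.mono fun a h x _ => (norm_coordForm_le _).trans <| by
      refine (Finset.sum_le_sum fun i _ => h i x).trans ?_
      simp)
    (hb.const_mul _) (hd.mono fun a h x _ => h x)
  refine key.congr_fderiv ?_
  simp only [coordForm]
  rw [integral_finsetSum _ fun i _ => (hGi i).smul_const _]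
  exact Finset.sum_congr rfl fun i _ => integral_smul_const _ _

lemma heatKer_pos {n : ℕ} (x : Euc n) {t : ℝ} (ht : 0 < t) : 0 < heatKer n x t := by
  unfold heatKer; positivity

lemma heatKer_nonneg {n : ℕ} (x : Euc n) {t : ℝ} (ht : 0 < t) : 0 ≤ heatKer n x t :=
  (heatKer_pos x ht).le

lemma measurable_heatKer (n : ℕ) : Measurable fun q : Euc n × ℝ => heatKer n q.1 q.2 := by
  unfold heatKer; fun_prop

lemma continuous_heatKer_left (n : ℕ) (t : ℝ) : Continuous fun x : Euc n => heatKer n x t := by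
  unfold heatKer; fun_prop

lemma heatKer_le {n : ℕ} (x : Euc n) {t : ℝ} (ht : 0 < t) :
    heatKer n x t ≤ (4 * π * t) ^ (-(n : ℝ) / 2) := by
  unfold heatKer
  refine mul_le_of_le_one_right (by positivity) (Real.exp_le_one_iff.2 ?_)
  rw [neg_div]
  exact neg_nonpos.2 (by positivity)

lemma integral_heatKer {n : ℕ} {t : ℝ} (ht : 0 < t) : ∫ y : Euc n, heatKer n y t = 1 := by
  have h := GaussianFourier.integral_rexp_neg_mul_sq_norm (V := Euc n) (b := 1 / (4 * t))
    (by positivity)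
  unfold heatKer
  rw [integral_const_mul]
  have e : ∀ v : Euc n, -‖v‖ ^ 2 / (4 * t) = -(1 / (4 * t)) * ‖v‖ ^ 2 := fun v => by ring
  simp only [e]
  rw [h, finrank_euclideanSpace_fin, show π / (1 / (4 * t)) = 4 * π * t by field_simp,
    ← rpow_add (by positivity)]
  rw [show -(n : ℝ) / 2 + n / 2 = 0 by ring, rpow_zero]

lemma integrable_heatKer {n : ℕ} {t : ℝ} (ht : 0 < t) :
    Integrable fun y : Euc n => heatKer n y t :=
  Integrable.of_integral_ne_zero (by rw [integral_heatKer ht]; exact one_ne_zero)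

lemma integrable_heatKer_sub {n : ℕ} (x : Euc n) {t : ℝ} (ht : 0 < t) :
    Integrable fun y : Euc n => heatKer n (x - y) t :=
  (integrable_heatKer ht).comp_sub_left x

lemma integral_heatKer_sub {n : ℕ} (x : Euc n) {t : ℝ} (ht : 0 < t) :
    ∫ y : Euc n, heatKer n (x - y) t = 1 := by
  rw [integral_sub_left_eq_self (fun y => heatKer n y t), integral_heatKer ht]

/-- Completing the square in a product of two heat kernels. -/
lemma heatKer_mul_heatKer {n : ℕ} (x z : Euc n) {a b : ℝ} (ha : 0 < a) (hb : 0 < b) :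
    heatKer n (x - z) a * heatKer n z b =
      heatKer n x (a + b) * heatKer n (z - (b / (a + b)) • x) (a * b / (a + b)) := by
  have hab : 0 < a + b := by positivity
  unfold heatKer
  have e1 : ((4 * π * a) ^ (-(n : ℝ) / 2)) * (4 * π * b) ^ (-(n : ℝ) / 2) =
      (4 * π * (a + b)) ^ (-(n : ℝ) / 2) * (4 * π * (a * b / (a + b))) ^ (-(n : ℝ) / 2) := by
    rw [← mul_rpow (by positivity) (by positivity), ← mul_rpow (by positivity) (by positivity)]
    congr 1
    field_simp
  have e2 : -‖x - z‖ ^ 2 / (4 * a) + -‖z‖ ^ 2 / (4 * b) =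
      -‖x‖ ^ 2 / (4 * (a + b)) + -‖z - (b / (a + b)) • x‖ ^ 2 / (4 * (a * b / (a + b))) := by
    rw [norm_sub_sq_real, norm_sub_sq_real, real_inner_smul_right, norm_smul,
      Real.norm_of_nonneg (by positivity : (0 : ℝ) ≤ b / (a + b)), real_inner_comm x z]
    field_simp
    ring
  rw [mul_mul_mul_comm, ← Real.exp_add, e1, e2, Real.exp_add, mul_mul_mul_comm]

lemma integrable_heatKer_mul {n : ℕ} (x : Euc n) {a b : ℝ} (ha : 0 < a) (hb : 0 < b) :
    Integrable fun z : Euc n => heatKer n (x - z) a * heatKer n z b := by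
  simp only [heatKer_mul_heatKer x _ ha hb]
  exact ((integrable_heatKer (by positivity)).comp_sub_right _).const_mul _

lemma integral_heatKer_mul {n : ℕ} (x : Euc n) {a b : ℝ} (ha : 0 < a) (hb : 0 < b) :
    ∫ z : Euc n, heatKer n (x - z) a * heatKer n z b = heatKer n x (a + b) := by
  simp only [heatKer_mul_heatKer x _ ha hb]
  rw [integral_const_mul, integral_sub_right_eq_self (fun y => heatKer n y (a * b / (a + b))),
    integral_heatKer (by positivity), mul_one]

/-- First spatial derivatives of the heat kernel. -/
def heatD1 (n : ℕ) (i : Fin n) (x : Euc n) (t : ℝ) : ℝ := -(x i / (2 * t)) * heatKer n x t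

/-- Second spatial derivatives of the heat kernel. -/
def heatD2 (n : ℕ) (i j : Fin n) (x : Euc n) (t : ℝ) : ℝ :=
  (x i * x j / (4 * t ^ 2) - (if i = j then 1 else 0) / (2 * t)) * heatKer n x t

/-- Third spatial derivatives of the heat kernel. -/
def heatD3 (n : ℕ) (i j k : Fin n) (x : Euc n) (t : ℝ) : ℝ :=
  (((if i = k then 1 else 0) * x j + (if j = k then 1 else 0) * x i) / (4 * t ^ 2)
    - (x i * x j / (4 * t ^ 2) - (if i = j then 1 else 0) / (2 * t)) * (x k / (2 * t)))
    * heatKer n x t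

lemma hasFDerivAt_coord {n : ℕ} (i : Fin n) (x : Euc n) :
    HasFDerivAt (fun y : Euc n => y i) (coordForm fun k => if i = k then 1 else 0) x := by
  refine (EuclideanSpace.proj i : Euc n →L[ℝ] ℝ).hasFDerivAt.congr_fderiv (eq_coordForm fun k => ?_)
  simp

lemma hasFDerivAt_heatKer {n : ℕ} (x : Euc n) (t : ℝ) :
    HasFDerivAt (fun y => heatKer n y t) (coordForm fun i => heatD1 n i x t) x := by
  have h := ((((hasStrictFDerivAt_norm_sq x).hasFDerivAt.neg.mul_const ((4 * t)⁻¹)).exp).const_mul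
    ((4 * π * t) ^ (-(n : ℝ) / 2)))
  refine h.congr_fderiv (eq_coordForm fun i => ?_)
  simp [heatD1, heatKer, ← div_eq_mul_inv, EuclideanSpace.inner_single_right]
  by_cases ht : t = 0
  · simp [ht]
  · field_simp
    ring_nf

lemma hasFDerivAt_heatD1 {n : ℕ} (i : Fin n) (x : Euc n) (t : ℝ) :
    HasFDerivAt (fun y => heatD1 n i y t) (coordForm fun j => heatD2 n i j x t) x := by
  have h := (((hasFDerivAt_coord i x).mul_const ((2 * t)⁻¹)).neg).mul (hasFDerivAt_heatKer x t)
  refine h.congr_fderiv (eq_coordForm fun j => ?_)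
  simp only [add_apply, smul_apply, neg_apply, Pi.neg_apply, smul_eq_mul,
    coordForm_single, heatD1, heatD2]
  ring

lemma hasFDerivAt_heatD2 {n : ℕ} (i j : Fin n) (x : Euc n) (t : ℝ) :
    HasFDerivAt (fun y => heatD2 n i j y t) (coordForm fun k => heatD3 n i j k x t) x := by
  have h := (((((hasFDerivAt_coord i x).mul (hasFDerivAt_coord j x)).mul_const
    ((4 * t ^ 2)⁻¹)).sub_const ((if i = j then 1 else 0) / (2 * t)))).mul (hasFDerivAt_heatKer x t)
  refine h.congr_fderiv (eq_coordForm fun k => ?_)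
  simp only [add_apply, smul_apply, Pi.mul_apply, smul_eq_mul,
    coordForm_single, heatD1, heatD3]
  ring

lemma measurable_heatD1 {n : ℕ} (i : Fin n) : Measurable fun q : Euc n × ℝ => heatD1 n i q.1 q.2 := by
  unfold heatD1 heatKer; fun_prop

lemma measurable_heatD2 {n : ℕ} (i j : Fin n) :
    Measurable fun q : Euc n × ℝ => heatD2 n i j q.1 q.2 := by
  unfold heatD2 heatKer; fun_prop

lemma measurable_heatD3 {n : ℕ} (i j k : Fin n) :
    Measurable fun q : Euc n × ℝ => heatD3 n i j k q.1 q.2 := by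
  unfold heatD3 heatKer; fun_prop

lemma heatKer_eq_two_mul {n : ℕ} (x : Euc n) {t : ℝ} (ht : 0 < t) :
    heatKer n x t = 2 ^ ((n : ℝ) / 2) * heatKer n x (2 * t) * Real.exp (-(‖x‖ ^ 2 / (8 * t))) := by
  unfold heatKer
  rw [show 4 * π * (2 * t) = 2 * (4 * π * t) by ring,
    mul_rpow (by positivity : (0 : ℝ) ≤ 2) (by positivity),
    show -‖x‖ ^ 2 / (4 * t) = -‖x‖ ^ 2 / (4 * (2 * t)) + -(‖x‖ ^ 2 / (8 * t)) by field_simp; ring,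
    Real.exp_add, neg_div, rpow_neg (by positivity : (0 : ℝ) ≤ 2)]
  have : (2 : ℝ) ^ ((n : ℝ) / 2) ≠ 0 := by positivity
  field_simp

lemma poly_mul_heatKer_le {n : ℕ} (x : Euc n) {t : ℝ} (ht : 0 < t) :
    (1 + ‖x‖ ^ 2 / (8 * t)) ^ 2 * heatKer n x t ≤ 2 * 2 ^ ((n : ℝ) / 2) * heatKer n x (2 * t) := by
  set q := ‖x‖ ^ 2 / (8 * t) with hq
  have hq0 : 0 ≤ q := by positivity
  have h1 : (1 + q) ^ 2 * Real.exp (-q) ≤ 2 := by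
    rw [Real.exp_neg, ← div_eq_mul_inv, div_le_iff₀ (Real.exp_pos _)]
    nlinarith [Real.quadratic_le_exp_of_nonneg hq0]
  rw [heatKer_eq_two_mul x ht, ← hq]
  have h2 : 0 ≤ (2 : ℝ) ^ ((n : ℝ) / 2) * heatKer n x (2 * t) :=
    mul_nonneg (by positivity) (heatKer_nonneg x (by positivity))
  nlinarith

lemma abs_ite_one_le (p : Prop) [Decidable p] : |(if p then 1 else 0 : ℝ)| ≤ 1 := by
  split_ifs <;> simp

/-- A constant controlling the derivatives of the heat kernel. -/
def heatConst (n : ℕ) : ℝ := 8 * 2 ^ ((n : ℝ) / 2)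

lemma heatConst_pos (n : ℕ) : 0 < heatConst n := by unfold heatConst; positivity

lemma mul_heatKer_le_of_le {n : ℕ} (x : Euc n) {t A e : ℝ} (ht : 0 < t)
    (hA : |A| ≤ t ^ e * (4 * (1 + ‖x‖ ^ 2 / (8 * t)) ^ 2)) :
    |A * heatKer n x t| ≤ heatConst n * t ^ e * heatKer n x (2 * t) := by
  rw [abs_mul, abs_of_nonneg (heatKer_nonneg x ht)]
  have h := poly_mul_heatKer_le x ht
  calc |A| * heatKer n x t ≤ t ^ e * (4 * (1 + ‖x‖ ^ 2 / (8 * t)) ^ 2) * heatKer n x t :=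
        mul_le_mul_of_nonneg_right hA (heatKer_nonneg x ht)
    _ = 4 * t ^ e * ((1 + ‖x‖ ^ 2 / (8 * t)) ^ 2 * heatKer n x t) := by ring
    _ ≤ 4 * t ^ e * (2 * 2 ^ ((n : ℝ) / 2) * heatKer n x (2 * t)) := by gcongr
    _ = _ := by unfold heatConst; ring

lemma rpow_neg_half_eq {t : ℝ} (m : ℕ) : t ^ (-(m : ℝ) / 2) = (√t ^ m)⁻¹ ∨ t < 0 := by
  rcases lt_or_ge t 0 with h | h
  · exact Or.inr h
  · left
    rw [neg_div, rpow_neg h, Real.sqrt_eq_rpow, ← rpow_natCast, ← rpow_mul h]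
    ring_nf

lemma abs_heatD1_le {n : ℕ} (i : Fin n) (x : Euc n) {t : ℝ} (ht : 0 < t) :
    |heatD1 n i x t| ≤ heatConst n * t ^ (-((1 : ℕ) : ℝ) / 2) * heatKer n x (2 * t) := by
  refine mul_heatKer_le_of_le x ht ?_
  rw [(rpow_neg_half_eq 1).resolve_right ht.not_gt]
  obtain ⟨s, hs, rfl⟩ : ∃ s : ℝ, 0 < s ∧ t = s ^ 2 := ⟨√t, by positivity, by rw [sq_sqrt ht.le]⟩
  rw [Real.sqrt_sq hs.le]
  obtain ⟨p, hp, hp'⟩ : ∃ p : ℝ, 0 ≤ p ∧ ‖x‖ = s * p := ⟨‖x‖ / s, by positivity, by field_simp⟩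
  have hx := hp' ▸ abs_coord_le x i
  rw [hp', abs_neg, abs_div, abs_of_pos (by positivity : 0 < 2 * s ^ 2)]
  calc |x i| / (2 * s ^ 2) ≤ s * p / (2 * s ^ 2) := by gcongr
    _ = (s ^ 1)⁻¹ * (p / 2) := by field_simp
    _ ≤ (s ^ 1)⁻¹ * (4 * (1 + p ^ 2 / 8) ^ 2) := by
      gcongr
      nlinarith [sq_nonneg (p - 1), sq_nonneg (p ^ 2)]
    _ = _ := by rw [show (s * p) ^ 2 / (8 * s ^ 2) = p ^ 2 / 8 by field_simp]

lemma abs_heatD2_le {n : ℕ} (i j : Fin n) (x : Euc n) {t : ℝ} (ht : 0 < t) :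
    |heatD2 n i j x t| ≤ heatConst n * t ^ (-((2 : ℕ) : ℝ) / 2) * heatKer n x (2 * t) := by
  refine mul_heatKer_le_of_le x ht ?_
  rw [(rpow_neg_half_eq 2).resolve_right ht.not_gt]
  obtain ⟨s, hs, rfl⟩ : ∃ s : ℝ, 0 < s ∧ t = s ^ 2 := ⟨√t, by positivity, by rw [sq_sqrt ht.le]⟩
  rw [Real.sqrt_sq hs.le]
  obtain ⟨p, hp, hp'⟩ : ∃ p : ℝ, 0 ≤ p ∧ ‖x‖ = s * p := ⟨‖x‖ / s, by positivity, by field_simp⟩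
  have hi := hp' ▸ abs_coord_le x i
  have hj := hp' ▸ abs_coord_le x j
  have hd := abs_ite_one_le (i = j)
  rw [hp']
  refine (abs_sub _ _).trans ?_
  rw [abs_div, abs_div, abs_mul, abs_of_pos (by positivity : 0 < 2 * s ^ 2),
    abs_of_pos (by positivity : 0 < 4 * (s ^ 2) ^ 2)]
  calc |x i| * |x j| / (4 * (s ^ 2) ^ 2) + |if i = j then 1 else 0| / (2 * s ^ 2)
      ≤ (s * p) * (s * p) / (4 * (s ^ 2) ^ 2) + 1 / (2 * s ^ 2) := by gcongr
    _ = (s ^ 2)⁻¹ * (p ^ 2 / 4 + 1 / 2) := by field_simp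
    _ ≤ (s ^ 2)⁻¹ * (4 * (1 + p ^ 2 / 8) ^ 2) := by
      gcongr
      nlinarith [sq_nonneg (p - 1), sq_nonneg (p ^ 2)]
    _ = _ := by rw [show (s * p) ^ 2 / (8 * s ^ 2) = p ^ 2 / 8 by field_simp]

lemma abs_heatD3_le {n : ℕ} (i j k : Fin n) (x : Euc n) {t : ℝ} (ht : 0 < t) :
    |heatD3 n i j k x t| ≤ heatConst n * t ^ (-((3 : ℕ) : ℝ) / 2) * heatKer n x (2 * t) := by
  refine mul_heatKer_le_of_le x ht ?_
  rw [(rpow_neg_half_eq 3).resolve_right ht.not_gt]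
  obtain ⟨s, hs, rfl⟩ : ∃ s : ℝ, 0 < s ∧ t = s ^ 2 := ⟨√t, by positivity, by rw [sq_sqrt ht.le]⟩
  rw [Real.sqrt_sq hs.le]
  obtain ⟨p, hp, hp'⟩ : ∃ p : ℝ, 0 ≤ p ∧ ‖x‖ = s * p := ⟨‖x‖ / s, by positivity, by field_simp⟩
  have hi := hp' ▸ abs_coord_le x i
  have hj := hp' ▸ abs_coord_le x j
  have hk := hp' ▸ abs_coord_le x k
  have hd := abs_ite_one_le (i = j)
  have hd1 := abs_ite_one_le (i = k)
  have hd2 := abs_ite_one_le (j = k)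
  rw [hp']
  have h2 : 0 < 2 * s ^ 2 := by positivity
  have h4 : 0 < 4 * (s ^ 2) ^ 2 := by positivity
  have a1 : |((if i = k then 1 else 0) * x j + (if j = k then 1 else 0) * x i) / (4 * (s ^ 2) ^ 2)|
      ≤ (1 * (s * p) + 1 * (s * p)) / (4 * (s ^ 2) ^ 2) := by
    rw [abs_div, abs_of_pos h4]
    gcongr
    refine (abs_add_le _ _).trans ?_
    rw [abs_mul, abs_mul]
    gcongr
  have a2 : |(x i * x j / (4 * (s ^ 2) ^ 2) - (if i = j then 1 else 0) / (2 * s ^ 2))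
      * (x k / (2 * s ^ 2))| ≤
      ((s * p) * (s * p) / (4 * (s ^ 2) ^ 2) + 1 / (2 * s ^ 2)) * ((s * p) / (2 * s ^ 2)) := by
    rw [abs_mul]
    gcongr
    · refine (abs_sub _ _).trans ?_
      rw [abs_div, abs_div, abs_mul, abs_of_pos h2, abs_of_pos h4]
      gcongr
    · rw [abs_div, abs_of_pos h2]
      gcongr
  refine (abs_sub _ _).trans ((add_le_add a1 a2).trans ?_)
  calc (1 * (s * p) + 1 * (s * p)) / (4 * (s ^ 2) ^ 2) +
        ((s * p) * (s * p) / (4 * (s ^ 2) ^ 2) + 1 / (2 * s ^ 2)) * ((s * p) / (2 * s ^ 2))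
      = (s ^ 3)⁻¹ * (p ^ 3 / 8 + 3 / 4 * p) := by field_simp; ring
    _ ≤ (s ^ 3)⁻¹ * (4 * (1 + p ^ 2 / 8) ^ 2) := by
      gcongr
      nlinarith [sq_nonneg (p - 1), sq_nonneg (p ^ 2 - p), sq_nonneg (p ^ 2 - 2 * p)]
    _ = _ := by rw [show (s * p) ^ 2 / (8 * s ^ 2) = p ^ 2 / 8 by field_simp]

lemma heatKer_two_mul_le {n : ℕ} (x : Euc n) {t : ℝ} (ht : 0 < t) :
    heatKer n x (2 * t) ≤ t ^ (-(n : ℝ) / 2) := by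
  refine (heatKer_le x (by positivity)).trans ?_
  refine rpow_le_rpow_of_nonpos ht ?_ ?_
  · nlinarith [Real.pi_gt_three]
  · rw [neg_div]; exact neg_nonpos.2 (by positivity)

lemma heat_sup_le {n m : ℕ} (x : Euc n) {t A : ℝ} (ht : 0 < t)
    (h : |A| ≤ heatConst n * t ^ (-(m : ℝ) / 2) * heatKer n x (2 * t)) :
    |A| ≤ heatConst n * t ^ (-((m : ℝ) + n) / 2) := by
  refine h.trans ?_
  rw [show -((m : ℝ) + n) / 2 = -(m : ℝ) / 2 + -(n : ℝ) / 2 by ring, rpow_add ht, ← mul_assoc]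
  have := heatConst_pos n
  gcongr
  exact heatKer_two_mul_le x ht

/-- A convolution identity with the heat kernel may be differentiated. -/
lemma heatKer_conv_gradient {n : ℕ} {a B : ℝ} (ha : 0 < a) {F Ft : Euc n → ℝ}
    {G Gt : Fin n → Euc n → ℝ}
    (hF : ∀ y, HasFDerivAt F (coordForm fun i => G i y) y)
    (hFt : ∀ y, HasFDerivAt Ft (coordForm fun i => Gt i y) y)
    (hFB : ∀ y, |F y| ≤ B) (hGB : ∀ i y, |G i y| ≤ B) (hG : ∀ i, Measurable (G i))
    (heq : ∀ x, ∫ z, heatKer n z a * F (x - z) = Ft x) (i : Fin n) (x : Euc n) :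
    ∫ z, heatKer n z a * G i (x - z) = Gt i x := by
  have hm : Measurable F :=
    (continuous_iff_continuousAt.2 fun y => (hF y).continuousAt).measurable
  have hk := (continuous_heatKer_left n a).measurable
  have key := hasFDerivAt_integral_coordForm (μ := (volume : Measure (Euc n)))
    (F := fun x z => heatKer n z a * F (x - z)) (G := fun i x z => heatKer n z a * G i (x - z))
    (b := fun z => heatKer n z a * B)
    (fun x => ((integrable_heatKer ha).mul_const B).mono'
      (by fun_prop) (Eventually.of_forall fun z => by
        rw [norm_mul, Real.norm_of_nonneg (heatKer_nonneg z ha)]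
        exact mul_le_mul_of_nonneg_left (hFB _) (heatKer_nonneg z ha)))
    (fun i x => by have := hG i; fun_prop)
    ((integrable_heatKer ha).mul_const B)
    (Eventually.of_forall fun z i x => by
      rw [abs_mul, abs_of_nonneg (heatKer_nonneg z ha)]
      exact mul_le_mul_of_nonneg_left (hGB _ _) (heatKer_nonneg z ha))
    (Eventually.of_forall fun z x => by
      have h := ((hF (x - z)).comp x ((hasFDerivAt_id x).sub_const z)).const_mul (heatKer n z a)
      refine h.congr_fderiv (eq_coordForm fun i => ?_)
      simp [coordForm_single]) x
  simp only [heq] at key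
  have := (hFt x).pd_coordForm i
  rw [← this, key.pd_coordForm i]

lemma heatKer_conv_comm {n : ℕ} (a : ℝ) (F : Euc n → ℝ) (x : Euc n) :
    ∫ z, heatKer n (x - z) a * F z = ∫ z, heatKer n z a * F (x - z) := by
  rw [← integral_sub_left_eq_self _ volume x]
  simp

lemma heatKer_conv_heatD3 {n : ℕ} {a b : ℝ} (ha : 0 < a) (hb : 0 < b) (i j k : Fin n) (x : Euc n) :
    ∫ z, heatKer n (x - z) a * heatD3 n i j k z b = heatD3 n i j k x (a + b) := by
  have h0 : ∀ x, ∫ z, heatKer n z a * heatKer n (x - z) b = heatKer n x (a + b) := fun x => by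
    rw [← heatKer_conv_comm a (fun y => heatKer n y b), integral_heatKer_mul x ha hb]
  have b0 : ∀ y, |heatKer n y b| ≤ (4 * π * b) ^ (-(n : ℝ) / 2) := fun y => by
    rw [abs_of_nonneg (heatKer_nonneg y hb)]; exact heatKer_le y hb
  have b1 := fun i (y : Euc n) => heat_sup_le y hb (abs_heatD1_le i y hb)
  have b2 := fun i j (y : Euc n) => heat_sup_le y hb (abs_heatD2_le i j y hb)
  have b3 := fun i j k (y : Euc n) => heat_sup_le y hb (abs_heatD3_le i j k y hb)
  have m1 := fun i => (measurable_heatD1 (n := n) i).comp (measurable_prodMk_right (y := b))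
  have m2 := fun i j => (measurable_heatD2 (n := n) i j).comp (measurable_prodMk_right (y := b))
  have m3 := fun i j k => (measurable_heatD3 (n := n) i j k).comp (measurable_prodMk_right (y := b))
  have h1 := heatKer_conv_gradient ha (fun y => hasFDerivAt_heatKer y b)
    (fun y => hasFDerivAt_heatKer y (a + b)) (fun y => (b0 y).trans (le_max_left _ _))
    (fun i y => (b1 i y).trans (le_max_right _ _)) m1 h0
  have h2 := heatKer_conv_gradient ha (fun y => hasFDerivAt_heatD1 i y b)
    (fun y => hasFDerivAt_heatD1 i y (a + b)) (fun y => (b1 i y).trans (le_max_left _ _))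
    (fun j y => (b2 i j y).trans (le_max_right _ _)) (m2 i) (h1 i)
  have h3 := heatKer_conv_gradient ha (fun y => hasFDerivAt_heatD2 i j y b)
    (fun y => hasFDerivAt_heatD2 i j y (a + b)) (fun y => (b2 i j y).trans (le_max_left _ _))
    (fun k y => (b3 i j k y).trans (le_max_right _ _)) (m3 i j) (h2 j)
  rw [heatKer_conv_comm a (fun z => heatD3 n i j k z b)]
  exact h3 k x

/-- The third-order derivative of the heat kernel entering the Oseen kernel. -/
def oseenD (n : ℕ) (i j k : Fin n) (x : Euc n) (t : ℝ) : ℝ :=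
  (if i = j then -∑ l, heatD3 n l l k x t else 0) + heatD3 n j i k x t

/-- The Oseen kernel as a time integral of derivatives of the heat kernel, extended by zero to
nonpositive times. -/
def oseenKer (n : ℕ) (i j k : Fin n) (x : Euc n) (t : ℝ) : ℝ :=
  if 0 < t then ∫ s in Set.Ioi (0 : ℝ), oseenD n i j k x (s + t) else 0

lemma measurable_oseenD {n : ℕ} (i j k : Fin n) :
    Measurable fun q : Euc n × ℝ => oseenD n i j k q.1 q.2 := by
  unfold oseenD
  refine Measurable.add ?_ (measurable_heatD3 j i k)
  split_ifs
  · exact (Finset.measurable_sum _ fun l _ => measurable_heatD3 l l k).neg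
  · exact measurable_const

lemma Measurable.oseenD {n : ℕ} (i j k : Fin n) {α : Type*} [MeasurableSpace α] {f : α → Euc n}
    {g : α → ℝ} (hf : Measurable f) (hg : Measurable g) :
    Measurable fun a => oseenD n i j k (f a) (g a) := by
  have h := (measurable_oseenD i j k).comp (hf.prodMk hg)
  exact h

lemma Measurable.heatKer {n : ℕ} {α : Type*} [MeasurableSpace α] {f : α → Euc n}
    {g : α → ℝ} (hf : Measurable f) (hg : Measurable g) :
    Measurable fun a => heatKer n (f a) (g a) :=
  (measurable_heatKer n).comp (hf.prodMk hg)

lemma measurable_oseenKer {n : ℕ} (i j k : Fin n) :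
    Measurable fun q : Euc n × ℝ => oseenKer n i j k q.1 q.2 := by
  unfold oseenKer
  refine Measurable.ite (measurableSet_lt measurable_const measurable_snd) ?_ measurable_const
  have h : Measurable fun p : (Euc n × ℝ) × ℝ => oseenD n i j k p.1.1 (p.2 + p.1.2) :=
    Measurable.oseenD i j k (by fun_prop) (by fun_prop)
  exact (h.stronglyMeasurable.integral_prod_right' (ν := volume.restrict (Set.Ioi (0 : ℝ)))).measurable

lemma abs_oseenD_le {n : ℕ} (i j k : Fin n) (x : Euc n) {t : ℝ} (ht : 0 < t) :
    |oseenD n i j k x t| ≤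
      ((n + 1) * heatConst n) * t ^ (-(3 : ℝ) / 2) * heatKer n x (2 * t) := by
  have h := fun i j k => abs_heatD3_le (n := n) i j k x ht
  push_cast at h
  unfold oseenD
  refine (abs_add_le _ _).trans ?_
  have h1 : |if i = j then -∑ l, heatD3 n l l k x t else 0| ≤
      n * (heatConst n * t ^ (-(3 : ℝ) / 2) * heatKer n x (2 * t)) := by
    split_ifs
    · rw [abs_neg]
      refine (Finset.abs_sum_le_sum_abs _ _).trans ((Finset.sum_le_sum fun l _ => h l l k).trans ?_)
      simp
    · have := heatConst_pos n
      have := heatKer_nonneg x (by positivity : 0 < 2 * t)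
      simp only [abs_zero]; positivity
  linarith [h j i k]

lemma integrableOn_shift {t : ℝ} (ht : 0 < t) {e : ℝ} (he : e < -1) :
    IntegrableOn (fun s : ℝ => (s + t) ^ e) (Set.Ioi 0) :=
  integrableOn_add_rpow_Ioi_of_lt he (by linarith)

lemma integral_shift {t : ℝ} (ht : 0 < t) :
    ∫ s in Set.Ioi (0 : ℝ), (s + t) ^ (-(3 : ℝ) / 2) = 2 * t ^ (-(1 : ℝ) / 2) := by
  have h := (measurePreserving_add_right (volume : Measure ℝ) t).setIntegral_preimage_emb
    (measurableEmbedding_addRight t) (fun s => s ^ (-(3 : ℝ) / 2)) (Set.Ioi t)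
  simp only [Set.preimage_add_const_Ioi, sub_self] at h
  rw [h, integral_Ioi_rpow_of_lt (by norm_num) ht]
  norm_num
  ring

lemma lintegral_oseenD_le {n : ℕ} (i j k : Fin n) {t : ℝ} (ht : 0 < t) :
    ∫⁻ x : Euc n, ‖oseenD n i j k x t‖ₑ ≤
      ENNReal.ofReal (((n + 1) * heatConst n) * t ^ (-(3 : ℝ) / 2)) := by
  have hK := heatConst_pos n
  calc ∫⁻ x : Euc n, ‖oseenD n i j k x t‖ₑ
      ≤ ∫⁻ x : Euc n, ENNReal.ofReal
          (((n + 1) * heatConst n) * t ^ (-(3 : ℝ) / 2) * heatKer n x (2 * t)) := by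
        refine lintegral_mono fun x => ?_
        rw [Real.enorm_eq_ofReal_abs]
        exact ENNReal.ofReal_le_ofReal (abs_oseenD_le i j k x ht)
    _ = _ := by
      rw [← ofReal_integral_eq_lintegral_ofReal
        ((integrable_heatKer (by positivity)).const_mul _)
        (Eventually.of_forall fun x => mul_nonneg (by positivity)
          (heatKer_nonneg x (by positivity))), integral_const_mul,
        integral_heatKer (by positivity), mul_one]

lemma lintegral_oseenKer_le {n : ℕ} (i j k : Fin n) (t : ℝ) :
    ∫⁻ x : Euc n, ‖oseenKer n i j k x t‖ₑ ≤
      (Set.Ioi (0 : ℝ)).indicator (fun t => ENNReal.ofReal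
        (((n + 1) * heatConst n) * (2 * t ^ (-(1 : ℝ) / 2)))) t := by
  have hK := heatConst_pos n
  unfold oseenKer
  by_cases ht : 0 < t
  · simp only [ht, if_true, Set.mem_Ioi, Set.indicator_of_mem]
    have hm : Measurable fun p : Euc n × ℝ => oseenD n i j k p.1 (p.2 + t) :=
      Measurable.oseenD i j k (by fun_prop) (by fun_prop)
    calc ∫⁻ x : Euc n, ‖∫ s in Set.Ioi (0 : ℝ), oseenD n i j k x (s + t)‖ₑ
        ≤ ∫⁻ x : Euc n, ∫⁻ s in Set.Ioi (0 : ℝ), ‖oseenD n i j k x (s + t)‖ₑ :=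
          lintegral_mono fun x => enorm_integral_le_lintegral_enorm _
      _ = ∫⁻ s in Set.Ioi (0 : ℝ), ∫⁻ x : Euc n, ‖oseenD n i j k x (s + t)‖ₑ :=
          lintegral_lintegral_swap hm.enorm.aemeasurable
      _ ≤ ∫⁻ s in Set.Ioi (0 : ℝ), ENNReal.ofReal
            (((n + 1) * heatConst n) * (s + t) ^ (-(3 : ℝ) / 2)) := by
          refine setLIntegral_mono' measurableSet_Ioi fun s hs => ?_
          exact lintegral_oseenD_le i j k (by have : 0 < s := hs; positivity)
      _ = _ := by
          rw [← ofReal_integral_eq_lintegral_ofReal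
            ((integrableOn_shift ht (by norm_num)).const_mul _)
            (ae_restrict_of_forall_mem measurableSet_Ioi fun s hs => by
              have : 0 < s := hs
              positivity), integral_const_mul, integral_shift ht]
  · simp [ht]

lemma integrableOn_oseenKer {n : ℕ} (i j k : Fin n) (M : ℝ) :
    IntegrableOn (fun q : Euc n × ℝ => oseenKer n i j k q.1 q.2) (Set.univ ×ˢ Set.Iio M) := by
  have hK := heatConst_pos n
  refine ⟨(measurable_oseenKer i j k).aestronglyMeasurable, ?_⟩
  rw [HasFiniteIntegral, Measure.volume_eq_prod, ← Measure.prod_restrict, Measure.restrict_univ,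
    lintegral_prod_symm _ (measurable_oseenKer i j k).enorm.aemeasurable]
  refine (lintegral_mono fun t => lintegral_oseenKer_le i j k t).trans_lt ?_
  rw [lintegral_indicator measurableSet_Ioi, Measure.restrict_restrict measurableSet_Ioi,
    Set.Ioi_inter_Iio]
  have hi : IntegrableOn (fun t : ℝ => ((n + 1) * heatConst n) * (2 * t ^ (-(1 : ℝ) / 2)))
      (Set.Ioo 0 M) := by
    refine Integrable.const_mul (Integrable.const_mul ?_ _) _
    have := (intervalIntegral.intervalIntegrable_rpow' (a := 0) (b := M)
      (by norm_num : (-1 : ℝ) < -(1 : ℝ) / 2))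
    exact (this.1).mono_set Set.Ioo_subset_Ioc_self
  exact (hi.lintegral_lt_top)

/-- Semigroup property of the Oseen kernel. -/
lemma heatKer_conv_oseenD {n : ℕ} (i j k : Fin n) {a b : ℝ} (ha : 0 < a) (hb : 0 < b) (x : Euc n) :
    ∫ z, heatKer n (x - z) a * oseenD n i j k z b = oseenD n i j k x (a + b) := by
  have hint : ∀ i j k, Integrable fun z => heatKer n (x - z) a * heatD3 n i j k z b := by
    intro i j k
    refine (integrable_heatKer_sub x ha).mul_bdd
      (c := heatConst n * b ^ (-(((3 : ℕ) : ℝ) + n) / 2))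
      ((measurable_heatD3 i j k).comp (measurable_prodMk_right (y := b))).aestronglyMeasurable
      (Eventually.of_forall fun z => heat_sup_le z hb (abs_heatD3_le i j k z hb))
  unfold oseenD
  by_cases h : i = j
  · simp only [h, if_true, mul_add, mul_neg, Finset.mul_sum]
    rw [integral_add (by exact (integrable_finsetSum _ fun l _ => hint l l k).neg) (hint j j k),
      integral_neg,
      integral_finsetSum _ fun l _ => hint l l k]
    simp only [heatKer_conv_heatD3 ha hb]
  · simp only [h, if_false, zero_add, heatKer_conv_heatD3 ha hb]

lemma abs_oseenD_le_sup {n : ℕ} (i j k : Fin n) (x : Euc n) {t : ℝ} (ht : 0 < t) :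
    |oseenD n i j k x t| ≤ ((n + 1) * heatConst n) * t ^ (-((3 : ℝ) + n) / 2) := by
  refine (abs_oseenD_le i j k x ht).trans ?_
  rw [show -((3 : ℝ) + n) / 2 = -(3 : ℝ) / 2 + -(n : ℝ) / 2 by ring, rpow_add ht, ← mul_assoc]
  have := heatConst_pos n
  gcongr
  exact heatKer_two_mul_le x ht

lemma heatKer_conv_oseenKer {n : ℕ} (i j k : Fin n) {a b : ℝ} (ha : 0 < a) (hb : 0 < b)
    (x : Euc n) :
    ∫ z, heatKer n (x - z) a * oseenKer n i j k z b = oseenKer n i j k x (a + b) := by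
  unfold oseenKer
  simp only [hb, add_pos ha hb, if_true, ← integral_const_mul]
  rw [integral_integral_swap]
  · refine setIntegral_congr_fun measurableSet_Ioi fun s hs => ?_
    have hs : 0 < s := hs
    rw [heatKer_conv_oseenD i j k ha (by positivity) x]
    congr 1
    ring
  · have hg : Integrable (fun p : Euc n × ℝ => heatKer n (x - p.1) a *
        (((n + 1) * heatConst n) * (p.2 + b) ^ (-((3 : ℝ) + n) / 2)))
        (volume.prod (volume.restrict (Set.Ioi (0 : ℝ)))) :=
      (integrable_heatKer_sub x ha).mul_prod
        ((integrableOn_shift hb (by have : (0 : ℝ) ≤ n := n.cast_nonneg; linarith)).const_mul _)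
    refine hg.mono' ?_ ?_
    · have h1 : Measurable fun p : Euc n × ℝ => heatKer n (x - p.1) a :=
        Measurable.heatKer (by fun_prop) (by fun_prop)
      have h2 : Measurable fun p : Euc n × ℝ => oseenD n i j k p.1 (p.2 + b) :=
        Measurable.oseenD i j k (by fun_prop) (by fun_prop)
      exact (h1.mul h2).aestronglyMeasurable
    · have : ∀ᵐ p : Euc n × ℝ ∂(volume.prod (volume.restrict (Set.Ioi (0 : ℝ)))), 0 < p.2 :=
        Measure.quasiMeasurePreserving_snd.ae
          (ae_restrict_of_forall_mem measurableSet_Ioi fun s hs => hs)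
      filter_upwards [this] with p hp
      simp only [Function.uncurry]
      rw [norm_mul, Real.norm_of_nonneg (heatKer_nonneg _ ha)]
      exact mul_le_mul_of_nonneg_left (abs_oseenD_le_sup i j k p.1 (by positivity))
        (heatKer_nonneg _ ha)

lemma rpow_inv_substitution {p a s : ℝ} (hs : 0 < s) :
    (|(-1 : ℝ)| * s ^ ((-1 : ℝ) - 1)) • ((s ^ (-1 : ℝ)) ^ ((p - 1) - 1) *
      Real.exp (-(a * s ^ (-1 : ℝ)))) = s ^ (-p) * Real.exp (-(a / s)) := by
  rw [← rpow_mul hs.le, abs_neg, abs_one, one_mul, smul_eq_mul, ← mul_assoc, ← rpow_add hs,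
    rpow_neg_one, div_eq_mul_inv]
  ring_nf

lemma integrableOn_rpow_mul_exp_neg_div {p a : ℝ} (hp : 1 < p) (ha : 0 < a) :
    IntegrableOn (fun s : ℝ => s ^ (-p) * Real.exp (-(a / s))) (Set.Ioi 0) := by
  have h : IntegrableOn (fun t : ℝ => t ^ ((p - 1) - 1) * Real.exp (-(a * t))) (Set.Ioi 0) :=
    .of_integral_ne_zero (by
      rw [Real.integral_rpow_mul_exp_neg_mul_Ioi (by linarith) ha]
      have := Real.Gamma_pos_of_pos (by linarith : 0 < p - 1)
      positivity)
  rw [← integrableOn_Ioi_comp_rpow_iff _ (by norm_num : (-1 : ℝ) ≠ 0)] at h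
  exact h.congr_fun (fun s hs => rpow_inv_substitution hs) measurableSet_Ioi

lemma integral_rpow_mul_exp_neg_div {p a : ℝ} (hp : 1 < p) (ha : 0 < a) :
    ∫ s in Set.Ioi (0 : ℝ), s ^ (-p) * Real.exp (-(a / s)) =
      (1 / a) ^ (p - 1) * Real.Gamma (p - 1) := by
  rw [← Real.integral_rpow_mul_exp_neg_mul_Ioi (by linarith) ha,
    ← integral_comp_rpow_Ioi (fun t => t ^ ((p - 1) - 1) * Real.exp (-(a * t)))
      (by norm_num : (-1 : ℝ) ≠ 0)]
  exact setIntegral_congr_fun measurableSet_Ioi fun s hs => (rpow_inv_substitution hs).symm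

lemma abs_exp_neg_sub_le (u v : ℝ) :
    |Real.exp (-u) - Real.exp (-v)| ≤ |u - v| * Real.exp (-min u v) := by
  wlog h : v ≤ u generalizing u v
  · rw [abs_sub_comm, abs_sub_comm u, min_comm]
    exact this v u (not_le.1 h).le
  rw [min_eq_right h, abs_of_nonneg (sub_nonneg.2 h), abs_sub_comm,
    abs_of_nonneg (sub_nonneg.2 (Real.exp_le_exp.2 (by linarith)))]
  have h1 : Real.exp (-u) = Real.exp (-(u - v)) * Real.exp (-v) := by
    rw [← Real.exp_add]; ring_nf
  have h2 := Real.add_one_le_exp (-(u - v))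
  rw [h1]
  nlinarith [Real.exp_pos (-v)]

/-- The radial profile of the heat kernel. -/
def heatRad (n : ℕ) (r s : ℝ) : ℝ := (4 * π * s) ^ (-(n : ℝ) / 2) * Real.exp (-r ^ 2 / (4 * s))

lemma heatKer_eq_heatRad {n : ℕ} (x : Euc n) (s : ℝ) : heatKer n x s = heatRad n ‖x‖ s := rfl

lemma measurable_heatRad (n : ℕ) (r : ℝ) : Measurable (heatRad n r) := by
  unfold heatRad; fun_prop

lemma heatRad_sub_eq (n : ℕ) (r s : ℝ) : heatRad n r s - heatRad n 1 s =
    (4 * π * s) ^ (-(n : ℝ) / 2) * (Real.exp (-(r ^ 2 / (4 * s))) - Real.exp (-(1 / (4 * s)))) := by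
  simp only [heatRad, neg_div, one_pow, mul_sub]

lemma abs_heatRad_sub_le (n : ℕ) (r : ℝ) {s : ℝ} (hs : 0 < s) :
    |heatRad n r s - heatRad n 1 s| ≤
      ((4 * π) ^ (-(n : ℝ) / 2) * |r ^ 2 - 1| / 4) *
        (s ^ (-((n : ℝ) / 2 + 1)) * Real.exp (-((min (r ^ 2) 1 / 4) / s))) := by
  rw [heatRad_sub_eq, abs_mul, abs_of_nonneg (by positivity)]
  refine (mul_le_mul_of_nonneg_left (abs_exp_neg_sub_le _ _) (by positivity)).trans_eq ?_
  have hmin : min (r ^ 2 / (4 * s)) (1 / (4 * s)) = min (r ^ 2) 1 / 4 / s := by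
    rw [min_div_div_right (by positivity), div_div]
  rw [hmin, ← sub_div, abs_div, abs_of_pos (by positivity : 0 < 4 * s),
    mul_rpow (by positivity) hs.le, neg_add, rpow_add hs, rpow_neg_one, neg_div]
  field_simp

lemma integrableOn_heatRad_sub (n : ℕ) (hn : 0 < n) {r : ℝ} (hr : 0 < r) :
    IntegrableOn (fun s => heatRad n r s - heatRad n 1 s) (Set.Ioi 0) := by
  have hn' : (0 : ℝ) < n := by exact_mod_cast hn
  refine Integrable.mono' ((integrableOn_rpow_mul_exp_neg_div (p := (n : ℝ) / 2 + 1)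
    (a := min (r ^ 2) 1 / 4) (by linarith) (by positivity)).const_mul
    ((4 * π) ^ (-(n : ℝ) / 2) * |r ^ 2 - 1| / 4))
    ((measurable_heatRad n r).sub (measurable_heatRad n 1)).aestronglyMeasurable ?_
  exact ae_restrict_of_forall_mem measurableSet_Ioi fun s hs => abs_heatRad_sub_le n r hs

/-- The radial potential obtained by integrating the renormalised heat kernel in time. -/
def heatPot (n : ℕ) (r : ℝ) : ℝ := ∫ s in Set.Ioi (0 : ℝ), (heatRad n r s - heatRad n 1 s)

lemma exists_hasDerivAt_heatPot (n : ℕ) (hn : 0 < n) :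
    ∃ B : ℝ, 0 < B ∧ ∀ r, 0 < r → HasDerivAt (heatPot n) (-(B * r ^ (1 - (n : ℝ)))) r := by
  have hn' : (0 : ℝ) < n := by exact_mod_cast hn
  refine ⟨(4 * π) ^ (-(n : ℝ) / 2) * Real.Gamma ((n : ℝ) / 2) * 4 ^ ((n : ℝ) / 2) / 2, ?_, ?_⟩
  · have := Real.Gamma_pos_of_pos (by linarith : 0 < (n : ℝ) / 2)
    positivity
  intro r hr
  set c := (4 * π) ^ (-(n : ℝ) / 2) with hc
  have hc0 : 0 < c := by positivity
  let F' : ℝ → ℝ → ℝ := fun ρ s => -(c * ρ / 2) * (s ^ (-((n : ℝ) / 2 + 1)) *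
    Real.exp (-((ρ ^ 2 / 4) / s)))
  have key := (hasDerivAt_integral_of_dominated_loc_of_deriv_le
    (μ := volume.restrict (Set.Ioi (0 : ℝ))) (𝕜 := ℝ) (x₀ := r) (s := Set.Ioo (r / 2) (2 * r))
    (F := fun ρ s => heatRad n ρ s - heatRad n 1 s) (F' := F')
    (bound := fun s => (c * r) * (s ^ (-((n : ℝ) / 2 + 1)) *
      Real.exp (-((r ^ 2 / 16) / s))))
    (Ioo_mem_nhds (by linarith) (by linarith))
    (Eventually.of_forall fun ρ =>
      ((measurable_heatRad n ρ).sub (measurable_heatRad n 1)).aestronglyMeasurable)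
    (integrableOn_heatRad_sub n hn hr)
    (by
      have : Measurable (F' r) := by fun_prop
      exact this.aestronglyMeasurable)
    (ae_restrict_of_forall_mem measurableSet_Ioi fun s hs ρ hρ => by
      have hs : 0 < s := hs
      have hρ0 : 0 < ρ := by linarith [hρ.1]
      simp only [F']
      rw [norm_mul, norm_neg, Real.norm_of_nonneg (by positivity),
        Real.norm_of_nonneg (by positivity)]
      refine mul_le_mul ?_ (mul_le_mul_of_nonneg_left (Real.exp_le_exp.2 (neg_le_neg ?_))
        (by positivity)) (by positivity) (by positivity)
      · nlinarith [hρ.2]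
      · exact div_le_div_of_nonneg_right (by nlinarith [hρ.1]) hs.le)
    ((integrableOn_rpow_mul_exp_neg_div (by linarith) (by positivity)).const_mul _)
    (ae_restrict_of_forall_mem measurableSet_Ioi fun s hs ρ hρ => by
      have hs : 0 < s := hs
      have h := (((((hasDerivAt_id ρ).pow 2).neg.div_const (4 * s)).exp).const_mul
        ((4 * π * s) ^ (-(n : ℝ) / 2))).sub_const (heatRad n 1 s)
      refine h.congr_deriv ?_
      simp only [F']
      rw [mul_rpow (by positivity) hs.le, neg_add, rpow_add hs, rpow_neg_one, ← hc, neg_div]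
      simp only [Pi.neg_apply, Pi.pow_apply, id]
      rw [show -(ρ ^ 2 / 4 / s) = -ρ ^ 2 / (4 * s) by field_simp]
      field_simp
      simp
      ring)).2
  refine key.congr_deriv ?_
  simp only [F']
  rw [integral_const_mul, integral_rpow_mul_exp_neg_div (by linarith) (by positivity),
    add_sub_cancel_right, show 1 / (r ^ 2 / 4) = 4 * (r ^ 2)⁻¹ by field_simp,
    mul_rpow (by positivity) (by positivity), inv_rpow (by positivity), ← rpow_natCast,
    ← rpow_mul hr.le, rpow_sub hr, rpow_one]
  rw [show ((2 : ℕ) : ℝ) * ((n : ℝ) / 2) = n by push_cast; ring]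
  field_simp

lemma exists_lapFund_eq (n : ℕ) (hn : 2 ≤ n) :
    ∃ c d : ℝ, ∀ y : Euc n, y ≠ 0 → lapFund n y = c * heatPot n ‖y‖ + d := by
  obtain ⟨B, hB, hder⟩ := exists_hasDerivAt_heatPot n (by omega)
  obtain ⟨ℓ, A, hℓ, hlap⟩ : ∃ (ℓ : ℝ → ℝ) (A : ℝ),
      (∀ r, 0 < r → HasDerivAt ℓ (A * r ^ (1 - (n : ℝ))) r) ∧
      ∀ y : Euc n, lapFund n y = ℓ ‖y‖ := by
    by_cases h2 : n = 2
    · refine ⟨fun r => (2 * π)⁻¹ * Real.log r, (2 * π)⁻¹, fun r hr => ?_, fun y => ?_⟩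
      · refine ((Real.hasDerivAt_log hr.ne').const_mul _).congr_deriv ?_
        rw [h2, show (1 : ℝ) - ((2 : ℕ) : ℝ) = -1 by norm_num, rpow_neg_one]
      · simp only [lapFund, if_pos h2]
    · refine ⟨fun r => -((((n : ℝ) - 2) * (2 * π ^ ((n : ℝ) / 2) / Real.Gamma ((n : ℝ) / 2)))⁻¹) *
        r ^ (2 - (n : ℝ)), -((((n : ℝ) - 2) *
        (2 * π ^ ((n : ℝ) / 2) / Real.Gamma ((n : ℝ) / 2)))⁻¹) * (2 - n), fun r hr => ?_, fun y => ?_⟩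
      · refine ((Real.hasDerivAt_rpow_const (Or.inl hr.ne')).const_mul _).congr_deriv ?_
        rw [← mul_assoc, show (2 : ℝ) - n - 1 = 1 - n by ring]
      · simp only [lapFund, if_neg h2]
  refine ⟨-(A / B), ℓ 1 + A / B * heatPot n 1, fun y hy => ?_⟩
  have hd : ∀ r ∈ Set.Ioi (0 : ℝ), HasDerivAt (fun r => ℓ r + A / B * heatPot n r) 0 r := by
    intro r hr
    refine ((hℓ r hr).add ((hder r hr).const_mul (A / B))).congr_deriv ?_
    field_simp
    ring
  have := (isOpen_Ioi (a := (0 : ℝ))).is_const_of_deriv_eq_zero isPreconnected_Ioi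
    (fun r hr => (hd r hr).differentiableAt.differentiableWithinAt)
    (fun r hr => (hd r hr).deriv) (norm_pos_iff.2 hy : ‖y‖ ∈ Set.Ioi (0 : ℝ))
    (Set.mem_Ioi.2 one_pos : (1 : ℝ) ∈ Set.Ioi (0 : ℝ))
  rw [hlap]
  linarith

lemma integrable_sq_mul_heatKer_sub {n : ℕ} (x : Euc n) {t : ℝ} (ht : 0 < t) :
    Integrable fun y : Euc n => (1 + ‖y‖ ^ 2) * heatKer n (x - y) t := by
  have h2 : (0 : ℝ) < 2 * t := by positivity
  refine Integrable.mono' ((integrable_heatKer_sub x h2).const_mul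
    ((1 + 2 * ‖x‖ ^ 2 + 16 * t) * (2 * 2 ^ ((n : ℝ) / 2)))) ?_ (Eventually.of_forall fun y => ?_)
  · have h1 : Measurable fun y : Euc n => heatKer n (x - y) t :=
      Measurable.heatKer (by fun_prop) (by fun_prop)
    exact ((by fun_prop : Measurable fun y : Euc n => 1 + ‖y‖ ^ 2).mul h1).aestronglyMeasurable
  · have hk := heatKer_nonneg (x - y) ht
    rw [norm_mul, Real.norm_of_nonneg (by positivity), Real.norm_of_nonneg hk]
    have hp := poly_mul_heatKer_le (x - y) ht
    set z := x - y with hz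
    have hy : ‖y‖ ≤ ‖x‖ + ‖z‖ := by
      have : y = x - z := by rw [hz]; abel
      rw [this]; exact norm_sub_le _ _
    have hy2 : ‖y‖ ^ 2 ≤ 2 * ‖x‖ ^ 2 + 2 * ‖z‖ ^ 2 := by
      nlinarith [norm_nonneg y, sq_nonneg (‖x‖ - ‖z‖), pow_le_pow_left₀ (norm_nonneg y) hy 2]
    have hq : ‖z‖ ^ 2 = 8 * t * (‖z‖ ^ 2 / (8 * t)) := by field_simp
    set q := ‖z‖ ^ 2 / (8 * t) with hqd
    have hq0 : 0 ≤ q := by positivity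
    have hfac : 1 + ‖y‖ ^ 2 ≤ (1 + 2 * ‖x‖ ^ 2 + 16 * t) * (1 + q) ^ 2 := by
      have h1 : 1 + ‖y‖ ^ 2 ≤ (1 + 2 * ‖x‖ ^ 2) + 16 * t * q := by rw [hq] at hy2; linarith
      have h3 : q ≤ (1 + q) ^ 2 := by nlinarith
      have h4 : 1 ≤ (1 + q) ^ 2 := by nlinarith
      have h5 : (0 : ℝ) ≤ 1 + 2 * ‖x‖ ^ 2 := by positivity
      nlinarith [mul_le_mul_of_nonneg_left h4 h5, mul_le_mul_of_nonneg_left h3 (by positivity : 0 ≤ 16 * t)]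
    calc (1 + ‖y‖ ^ 2) * heatKer n z t
        ≤ (1 + 2 * ‖x‖ ^ 2 + 16 * t) * (1 + q) ^ 2 * heatKer n z t :=
          mul_le_mul_of_nonneg_right hfac hk
      _ = (1 + 2 * ‖x‖ ^ 2 + 16 * t) * ((1 + q) ^ 2 * heatKer n z t) := by ring
      _ ≤ (1 + 2 * ‖x‖ ^ 2 + 16 * t) * (2 * 2 ^ ((n : ℝ) / 2) * heatKer n z (2 * t)) := by
          gcongr
      _ = _ := by ring

lemma integrableOn_heatRad_one (n : ℕ) (hn : 0 < n) :
    IntegrableOn (heatRad n 1) (Set.Ioc 0 1) := by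
  have hn' : (0 : ℝ) < n := by exact_mod_cast hn
  refine Integrable.mono' (((integrableOn_rpow_mul_exp_neg_div (p := (n : ℝ) / 2 + 1)
    (a := 1 / 4) (by linarith) (by positivity)).const_mul
    ((4 * π) ^ (-(n : ℝ) / 2))).mono_measure (Measure.restrict_mono Set.Ioc_subset_Ioi_self le_rfl))
    (measurable_heatRad n 1).aestronglyMeasurable
    (ae_restrict_of_forall_mem measurableSet_Ioc fun s hs => ?_)
  have hs0 : 0 < s := hs.1
  rw [heatRad, Real.norm_of_nonneg (by positivity), mul_rpow (by positivity) hs0.le, mul_assoc,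
    show -(1 / 4 / s) = -1 ^ 2 / (4 * s) by field_simp]
  gcongr ?_ * (?_ * ?_)
  exact rpow_le_rpow_of_exponent_ge hs0 hs.2 (by linarith)

lemma integrable_renormalized {n : ℕ} (hn : 0 < n) (x : Euc n) {t : ℝ} (ht : 0 < t) :
    Integrable (fun p : Euc n × ℝ => (heatKer n p.1 p.2 - heatRad n 1 p.2) * heatKer n (x - p.1) t)
      (volume.prod (volume.restrict (Set.Ioi 0))) := by
  have hn' : (0 : ℝ) < n := by exact_mod_cast hn
  have mK : Measurable fun p : Euc n × ℝ => heatKer n p.1 p.2 := measurable_heatKer n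
  have mR : Measurable fun p : Euc n × ℝ => heatRad n 1 p.2 :=
    (measurable_heatRad n 1).comp measurable_snd
  have mX : Measurable fun p : Euc n × ℝ => heatKer n (x - p.1) t :=
    Measurable.heatKer (by fun_prop) (by fun_prop)
  rw [← Set.Ioc_union_Ioi_eq_Ioi zero_le_one, Measure.restrict_union (by
    rw [Set.disjoint_left]; intro s hs hs'; exact absurd hs.2 (not_le.2 hs')) measurableSet_Ioi,
    Measure.prod_add]
  refine Integrable.add_measure ?_ ?_
  · have hA : Integrable (fun p : Euc n × ℝ => heatKer n p.1 p.2 * heatKer n (x - p.1) t)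
        (volume.prod (volume.restrict (Set.Ioc 0 1))) := by
      have mKX : Measurable fun p : Euc n × ℝ => heatKer n p.1 p.2 * heatKer n (x - p.1) t :=
        mK.mul mX
      rw [integrable_prod_iff' mKX.aestronglyMeasurable]
      constructor
      · refine ae_restrict_of_forall_mem measurableSet_Ioc fun s hs => ?_
        simpa only [mul_comm] using integrable_heatKer_mul x ht hs.1
      · refine Measure.integrableOn_of_bounded (M := (4 * π * t) ^ (-(n : ℝ) / 2)) (by simp)
          (mKX.norm.stronglyMeasurable.integral_prod_left').aestronglyMeasurable
          (ae_restrict_of_forall_mem measurableSet_Ioc fun s hs => ?_)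
        have hs0 : 0 < s := hs.1
        have : ∀ y : Euc n, ‖heatKer n y s * heatKer n (x - y) t‖ =
            heatKer n (x - y) t * heatKer n y s := fun y => by
          rw [norm_mul, Real.norm_of_nonneg (heatKer_nonneg _ hs0),
            Real.norm_of_nonneg (heatKer_nonneg _ ht), mul_comm]
        simp only [this]
        rw [integral_heatKer_mul x ht hs0, Real.norm_of_nonneg (heatKer_nonneg _ (by positivity))]
        refine (heatKer_le x (by positivity)).trans
          (rpow_le_rpow_of_nonpos (by positivity) (by gcongr; linarith) ?_)
        rw [neg_div]; linarith
    have hB := (integrable_heatKer_sub x ht).mul_prod (integrableOn_heatRad_one n hn)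
    exact (hA.sub hB).congr (Eventually.of_forall fun p => by simp only [Pi.sub_apply]; ring)
  · have hi : IntegrableOn (fun s : ℝ => s ^ (-((n : ℝ) / 2 + 1))) (Set.Ioi 1) :=
      integrableOn_Ioi_rpow_of_lt (by linarith) one_pos
    refine Integrable.mono' (((integrable_sq_mul_heatKer_sub x ht).mul_prod hi).const_mul
      ((4 * π) ^ (-(n : ℝ) / 2) / 4)) ((mK.sub mR).mul mX).aestronglyMeasurable ?_
    have hae : ∀ᵐ p : Euc n × ℝ ∂(volume.prod (volume.restrict (Set.Ioi (1 : ℝ)))),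
        p.2 ∈ Set.Ioi (1 : ℝ) :=
      Measure.quasiMeasurePreserving_snd.ae (ae_restrict_mem measurableSet_Ioi)
    filter_upwards [hae] with p hp
    have hs : 0 < p.2 := one_pos.trans hp
    rw [norm_mul, Real.norm_of_nonneg (heatKer_nonneg _ ht), Real.norm_eq_abs, heatKer_eq_heatRad]
    have h1 := abs_heatRad_sub_le n ‖p.1‖ hs
    have h2 : |‖p.1‖ ^ 2 - 1| ≤ 1 + ‖p.1‖ ^ 2 := by
      rw [abs_le]; constructor <;> nlinarith [sq_nonneg ‖p.1‖]
    have h3 : Real.exp (-((min (‖p.1‖ ^ 2) 1 / 4) / p.2)) ≤ 1 :=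
      Real.exp_le_one_iff.2 (by
        rw [neg_nonpos]; have : 0 ≤ min (‖p.1‖ ^ 2) 1 := by positivity
        positivity)
    calc _ ≤ ((4 * π) ^ (-(n : ℝ) / 2) * (1 + ‖p.1‖ ^ 2) / 4) *
          (p.2 ^ (-((n : ℝ) / 2 + 1)) * 1) * heatKer n (x - p.1) t := by
          refine mul_le_mul_of_nonneg_right (h1.trans ?_) (heatKer_nonneg _ ht)
          gcongr
      _ = _ := by ring

lemma exists_genPhi_eq (n : ℕ) (hn : 2 ≤ n) : ∃ c d : ℝ, ∀ (x : Euc n) (t : ℝ), 0 < t →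
    Integrable (fun s => heatKer n x (s + t) - heatRad n 1 s) (volume.restrict (Set.Ioi 0)) ∧
    genPhi n x t = d + c * ∫ s in Set.Ioi (0 : ℝ), (heatKer n x (s + t) - heatRad n 1 s) := by
  obtain ⟨c, d, h⟩ := exists_lapFund_eq n hn
  refine ⟨c, d, fun x t ht => ?_⟩
  have : NeZero n := ⟨by omega⟩
  have hF := integrable_renormalized (by omega) x ht
  have hinner : ∀ s ∈ Set.Ioi (0 : ℝ), ∫ y, (heatKer n y s - heatRad n 1 s) * heatKer n (x - y) t =
      heatKer n x (s + t) - heatRad n 1 s := by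
    intro s hs
    have e1 : ∀ y, (heatKer n y s - heatRad n 1 s) * heatKer n (x - y) t =
      heatKer n (x - y) t * heatKer n y s - heatRad n 1 s * heatKer n (x - y) t := fun y => by ring
    simp only [e1]
    rw [integral_sub (integrable_heatKer_mul x ht hs) ((integrable_heatKer_sub x ht).const_mul _),
      integral_heatKer_mul x ht hs, integral_const_mul, integral_heatKer_sub x ht, mul_one,
      add_comm]
  constructor
  · exact hF.integral_prod_right.congr (ae_restrict_of_forall_mem measurableSet_Ioi hinner)
  have hne : ∀ᵐ y : Euc n, y ≠ 0 := by
    simp [ae_iff]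
  have e2 : ∀ᵐ y : Euc n, lapFund n y * heatKer n (x - y) t =
      d * heatKer n (x - y) t + c * ∫ s in Set.Ioi (0 : ℝ),
        (heatKer n y s - heatRad n 1 s) * heatKer n (x - y) t := by
    filter_upwards [hne] with y hy
    rw [h y hy, integral_mul_const]
    simp only [heatPot, heatKer_eq_heatRad]
    ring
  rw [genPhi, integral_congr_ae e2, integral_add ((integrable_heatKer_sub x ht).const_mul _)
    (hF.integral_prod_left.const_mul _), integral_const_mul, integral_heatKer_sub x ht, mul_one,
    integral_const_mul, integral_integral_swap hF]
  rw [setIntegral_congr_fun measurableSet_Ioi hinner]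

lemma abs_heat_shift_le {n : ℕ} {x : Euc n} {s t A : ℝ} {m : ℕ} (hs : 0 < s) (ht : 0 < t)
    (h : |A| ≤ heatConst n * (s + t) ^ (-(m : ℝ) / 2) * heatKer n x (2 * (s + t))) :
    |A| ≤ heatConst n * (s + t) ^ (-((m : ℝ) + n) / 2) :=
  heat_sup_le x (by positivity) h

lemma integrable_heat_bound {n m : ℕ} (h : 2 < m + n) {t : ℝ} (ht : 0 < t) :
    Integrable (fun s : ℝ => heatConst n * (s + t) ^ (-((m : ℝ) + n) / 2))
      (volume.restrict (Set.Ioi 0)) := by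
  have : (2 : ℝ) < m + n := by exact_mod_cast h
  exact (integrableOn_shift ht (by linarith)).const_mul _

lemma exists_Kten_eq (n : ℕ) (hn : 2 ≤ n) : ∃ c : ℝ, ∀ (i j k : Fin n) (x : Euc n) (t : ℝ), 0 < t →
    Kten n i j k x t = c * oseenKer n i j k x t := by
  obtain ⟨c, d, h⟩ := exists_genPhi_eq n hn
  refine ⟨c, fun i j k x t ht => ?_⟩
  set μ := volume.restrict (Set.Ioi (0 : ℝ)) with hμ
  have m1 : ∀ i (x : Euc n), Measurable fun s => heatD1 n i x (s + t) := fun i x => by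
    have h := (measurable_heatD1 (n := n) i).comp ((measurable_const (a := x)).prodMk (measurable_id.add_const t))
    exact h
  have m2 : ∀ i j (x : Euc n), Measurable fun s => heatD2 n i j x (s + t) := fun i j x => by
    have h := (measurable_heatD2 (n := n) i j).comp ((measurable_const (a := x)).prodMk (measurable_id.add_const t))
    exact h
  have m3 : ∀ i j k (x : Euc n), Measurable fun s => heatD3 n i j k x (s + t) := fun i j k x => by
    have h := (measurable_heatD3 (n := n) i j k).comp ((measurable_const (a := x)).prodMk (measurable_id.add_const t))
    exact h
  have b1 : ∀ᵐ s ∂μ, ∀ i (x : Euc n), |heatD1 n i x (s + t)| ≤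
      heatConst n * (s + t) ^ (-(((1 : ℕ) : ℝ) + n) / 2) :=
    ae_restrict_of_forall_mem measurableSet_Ioi fun s hs i x =>
      abs_heat_shift_le hs ht (abs_heatD1_le i x (add_pos hs ht))
  have b2 : ∀ i, ∀ᵐ s ∂μ, ∀ j (x : Euc n), |heatD2 n i j x (s + t)| ≤
      heatConst n * (s + t) ^ (-(((2 : ℕ) : ℝ) + n) / 2) := fun i =>
    ae_restrict_of_forall_mem measurableSet_Ioi fun s hs j x =>
      abs_heat_shift_le hs ht (abs_heatD2_le i j x (add_pos hs ht))
  have b3 : ∀ i j, ∀ᵐ s ∂μ, ∀ k (x : Euc n), |heatD3 n i j k x (s + t)| ≤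
      heatConst n * (s + t) ^ (-(((3 : ℕ) : ℝ) + n) / 2) := fun i j =>
    ae_restrict_of_forall_mem measurableSet_Ioi fun s hs k x =>
      abs_heat_shift_le hs ht (abs_heatD3_le i j k x (add_pos hs ht))
  have i1 : ∀ i (x : Euc n), Integrable (fun s => heatD1 n i x (s + t)) μ := fun i x =>
    (integrable_heat_bound (by omega) ht).mono' (m1 i x).aestronglyMeasurable
      (b1.mono fun s hs => hs i x)
  have i2 : ∀ i j (x : Euc n), Integrable (fun s => heatD2 n i j x (s + t)) μ := fun i j x =>
    (integrable_heat_bound (by omega) ht).mono' (m2 i j x).aestronglyMeasurable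
      ((b2 i).mono fun s hs => hs j x)
  have i3 : ∀ i j k (x : Euc n), Integrable (fun s => heatD3 n i j k x (s + t)) μ := fun i j k x =>
    (integrable_heat_bound (by omega) ht).mono' (m3 i j k x).aestronglyMeasurable
      ((b3 i j).mono fun s hs => hs k x)
  have d0 : ∀ x : Euc n, HasFDerivAt (fun x => genPhi n x t)
      (coordForm fun i => c * ∫ s, heatD1 n i x (s + t) ∂μ) x := by
    intro x
    have hh := hasFDerivAt_integral_coordForm (μ := μ)
      (F := fun x s => heatKer n x (s + t) - heatRad n 1 s)
      (G := fun i x s => heatD1 n i x (s + t))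
      (fun x => (h x t ht).1) (fun i x => (m1 i x).aestronglyMeasurable)
      (integrable_heat_bound (by omega) ht) (b1.mono fun s hs i x => hs i x)
      (Eventually.of_forall fun s x => (hasFDerivAt_heatKer x (s + t)).sub_const _) x
    have e : (fun x => genPhi n x t) = fun x => d + c * ∫ s, (heatKer n x (s + t) - heatRad n 1 s) ∂μ :=
      funext fun x => (h x t ht).2
    rw [e]
    refine ((hh.const_mul c).const_add d).congr_fderiv ?_
    refine eq_coordForm fun i => ?_
    simp [coordForm_single]
  have d1 : ∀ i (x : Euc n), HasFDerivAt (fun x => c * ∫ s, heatD1 n i x (s + t) ∂μ)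
      (coordForm fun j => c * ∫ s, heatD2 n i j x (s + t) ∂μ) x := by
    intro i x
    have hh := hasFDerivAt_integral_coordForm (μ := μ)
      (F := fun x s => heatD1 n i x (s + t))
      (G := fun j x s => heatD2 n i j x (s + t))
      (i1 i) (fun j x => (m2 i j x).aestronglyMeasurable)
      (integrable_heat_bound (by omega) ht) (b2 i)
      (Eventually.of_forall fun s x => hasFDerivAt_heatD1 i x (s + t)) x
    refine (hh.const_mul c).congr_fderiv ?_
    refine eq_coordForm fun i => ?_
    simp [coordForm_single]
  have d2 : ∀ i j (x : Euc n), HasFDerivAt (fun x => c * ∫ s, heatD2 n i j x (s + t) ∂μ)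
      (coordForm fun k => c * ∫ s, heatD3 n i j k x (s + t) ∂μ) x := by
    intro i j x
    have hh := hasFDerivAt_integral_coordForm (μ := μ)
      (F := fun x s => heatD2 n i j x (s + t))
      (G := fun k x s => heatD3 n i j k x (s + t))
      (i2 i j) (fun k x => (m3 i j k x).aestronglyMeasurable)
      (integrable_heat_bound (by omega) ht) (b3 i j)
      (Eventually.of_forall fun s x => hasFDerivAt_heatD2 i j x (s + t)) x
    refine (hh.const_mul c).congr_fderiv ?_
    refine eq_coordForm fun i => ?_
    simp [coordForm_single]
  have p1 : ∀ i, pd n i (fun x => genPhi n x t) = fun x => c * ∫ s, heatD1 n i x (s + t) ∂μ :=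
    fun i => funext fun x => (d0 x).pd_coordForm i
  have p2 : ∀ i j, pd n i (pd n j fun x => genPhi n x t) =
      fun x => c * ∫ s, heatD2 n j i x (s + t) ∂μ := fun i j => by
    rw [p1]; exact funext fun x => (d1 j x).pd_coordForm i
  have hK : (fun x => Kmat n i j x t) = fun x =>
      (if i = j then -∑ l, c * ∫ s, heatD2 n l l x (s + t) ∂μ else 0) +
        c * ∫ s, heatD2 n j i x (s + t) ∂μ := by
    funext x
    simp only [Kmat, lap, p2]
  have hder : HasFDerivAt (fun x => Kmat n i j x t) (coordForm fun k =>
      (if i = j then -∑ l, c * ∫ s, heatD3 n l l k x (s + t) ∂μ else 0) +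
        c * ∫ s, heatD3 n j i k x (s + t) ∂μ) x := by
    rw [hK]
    by_cases hij : i = j
    · simp only [hij, if_true]
      refine (((HasFDerivAt.fun_sum fun l _ => d2 l l x).neg).add (d2 j j x)).congr_fderiv ?_
      refine eq_coordForm fun k => ?_
      simp [coordForm_single]
    · simpa only [hij, if_false, zero_add] using d2 j i x
  rw [Kten, hder.pd_coordForm k, oseenKer, if_pos ht]
  unfold oseenD
  by_cases hij : i = j
  · simp only [hij, if_true]
    rw [integral_add (by exact (integrable_finsetSum _ fun l _ => i3 l l k x).neg) (i3 j j k x),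
      integral_neg, integral_finsetSum _ fun l _ => i3 l l k x, ← Finset.mul_sum]
    ring
  · simp only [hij, if_false, zero_add, hμ]

/-- Reflected translates of an integrable function depend continuously on the centre in `L¹`. -/
lemma tendsto_integral_abs_sub_translate {E : Type*} [NormedAddCommGroup E]
    [MeasurableSpace E] [BorelSpace E] {μ : Measure E}
    [μ.IsAddLeftInvariant] [μ.IsNegInvariant] [μ.InnerRegularCompactLTTop]
    [IsLocallyFiniteMeasure μ]
    {g : E → ℝ} (hg : Integrable g μ) (p : E) :
    Tendsto (fun q => ∫ w, |g (q - w) - g (p - w)| ∂μ) (𝓝 p) (𝓝 0) := by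
  let r : E → C(E, E) := fun q => ⟨fun w => q - w, by fun_prop⟩
  have hr : Continuous r := ContinuousMap.continuous_of_continuous_uncurry _ (by
    simp only [r, Function.uncurry_def, ContinuousMap.coe_mk]; fun_prop)
  have hmp : ∀ q, MeasurePreserving (r q) μ μ := fun q => μ.measurePreserving_sub_left q
  have h := (Filter.Tendsto.compMeasurePreservingLp (p := 1)
    (tendsto_const_nhds (x := hg.toL1 g)) (hr.tendsto p) hmp (hmp p) (by simp))
  rw [tendsto_iff_norm_sub_tendsto_zero] at h
  refine h.congr fun q => ?_
  rw [L1.norm_eq_integral_norm]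
  refine integral_congr_ae ?_
  have e : ∀ q, (Lp.compMeasurePreserving (r q) (hmp q) (hg.toL1 g) : E → ℝ) =ᵐ[μ]
      fun w => g (q - w) := fun q =>
    (Lp.coeFn_compMeasurePreserving _ (hmp q)).trans
      ((hmp q).quasiMeasurePreserving.ae_eq hg.coeFn_toL1)
  filter_upwards [Lp.coeFn_sub (Lp.compMeasurePreserving (r q) (hmp q) (hg.toL1 g))
    (Lp.compMeasurePreserving (r p) (hmp p) (hg.toL1 g)), e q, e p] with w h1 h2 h3
  rw [h1, Pi.sub_apply, h2, h3, Real.norm_eq_abs]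

instance isAddHaarMeasure_volume_spaceTime (n : ℕ) :
    (volume : Measure (Euc n × ℝ)).IsAddHaarMeasure :=
  inferInstanceAs (Measure.prod (volume : Measure (Euc n)) (volume : Measure ℝ)).IsAddHaarMeasure

/-- Kernels on space-time supported in positive times and integrable over bounded times. -/
structure IsCausalKernel {n : ℕ} (k : Euc n × ℝ → ℝ) : Prop where
  measurable : Measurable k
  eq_zero : ∀ q, q.2 ≤ 0 → k q = 0
  integrableOn : ∀ M, IntegrableOn k (Set.univ ×ˢ Set.Iio M)

/-- Bounded measurable sources supported in times after `S`. -/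
structure IsSource {n : ℕ} (S B : ℝ) (f : Euc n × ℝ → ℝ) : Prop where
  measurable : Measurable f
  bound : ∀ w, |f w| ≤ B
  eq_zero : ∀ w, w.2 ≤ S → f w = 0

/-- Truncation of a kernel to times below `M`. -/
def truncKer {n : ℕ} (k : Euc n × ℝ → ℝ) (M : ℝ) : Euc n × ℝ → ℝ :=
  (Set.univ ×ˢ Set.Iio M).indicator k

section Causal

variable {n : ℕ} {k f : Euc n × ℝ → ℝ} {S B M : ℝ}

lemma IsCausalKernel.integrable_truncKer (hk : IsCausalKernel k) (M : ℝ) :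
    Integrable (truncKer k M) :=
  (integrable_indicator_iff (MeasurableSet.univ.prod measurableSet_Iio)).2 (hk.integrableOn M)

lemma truncKer_mul (hf : IsSource S B f) {z : Euc n × ℝ} (hz : z.2 < S + M) (w : Euc n × ℝ) :
    truncKer k M (z - w) * f w = k (z - w) * f w := by
  by_cases hw : w.2 ≤ S
  · rw [hf.eq_zero w hw, mul_zero, mul_zero]
  · rw [truncKer, Set.indicator_of_mem]
    simp only [Set.mem_prod, Set.mem_univ, true_and, Set.mem_Iio, Prod.snd_sub]
    linarith

lemma IsCausalKernel.integrable_truncKer_sub (hk : IsCausalKernel k) (M : ℝ) (z : Euc n × ℝ) :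
    Integrable fun w => truncKer k M (z - w) :=
  (hk.integrable_truncKer M).comp_sub_left z

lemma IsCausalKernel.integrable_conv (hk : IsCausalKernel k) (hf : IsSource S B f)
    (z : Euc n × ℝ) : Integrable fun w => k (z - w) * f w := by
  have hz : z.2 < S + (z.2 - S + 1) := by linarith
  refine ((hk.integrable_truncKer_sub (z.2 - S + 1) z).mul_bdd
    hf.measurable.aestronglyMeasurable (c := B) (Eventually.of_forall hf.bound)).congr
    (Eventually.of_forall fun w => truncKer_mul hf hz w)

lemma IsCausalKernel.integral_abs_conv_le (hk : IsCausalKernel k) (hf : IsSource S B f)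
    {z : Euc n × ℝ} (hz : z.2 < S + M) :
    ∫ w, |k (z - w) * f w| ≤ B * ∫ w, |truncKer k M w| := by
  rw [← integral_sub_left_eq_self (fun w => |truncKer k M w|) volume z, ← integral_const_mul]
  refine integral_mono (hk.integrable_conv hf z).abs
    ((hk.integrable_truncKer_sub M z).abs.const_mul B) fun w => ?_
  simp only
  rw [← truncKer_mul hf hz, abs_mul, mul_comm]
  exact mul_le_mul_of_nonneg_right (hf.bound w) (abs_nonneg _)

lemma IsCausalKernel.abs_conv_sub_le (hk : IsCausalKernel k) (hf : IsSource S B f)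
    {p q : Euc n × ℝ} (hp : p.2 < S + M) (hq : q.2 < S + M) :
    |(∫ w, k (q - w) * f w) - ∫ w, k (p - w) * f w| ≤
      B * ∫ w, |truncKer k M (q - w) - truncKer k M (p - w)| := by
  rw [← integral_sub (hk.integrable_conv hf q) (hk.integrable_conv hf p), ← integral_const_mul]
  refine (abs_integral_le_integral_abs).trans (integral_mono
    ((hk.integrable_conv hf q).sub (hk.integrable_conv hf p)).abs
    (((hk.integrable_truncKer_sub M q).sub (hk.integrable_truncKer_sub M p)).abs.const_mul B)
    fun w => ?_)
  simp only
  rw [← truncKer_mul hf hp, ← truncKer_mul hf hq, ← sub_mul, abs_mul, mul_comm]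
  exact mul_le_mul_of_nonneg_right (hf.bound w) (abs_nonneg _)

lemma IsCausalKernel.tendsto_conv (hk : IsCausalKernel k) {F : ℕ → Euc n × ℝ → ℝ}
    (hF : ∀ᶠ m in atTop, IsSource S B (F m)) (z : Euc n × ℝ)
    (hlim : ∀ w, Tendsto (fun m => F m w) atTop (𝓝 (f w))) :
    Tendsto (fun m => ∫ w, k (z - w) * F m w) atTop (𝓝 (∫ w, k (z - w) * f w)) := by
  have hz : z.2 < S + (z.2 - S + 1) := by linarith
  refine tendsto_integral_filter_of_dominated_convergence
    (fun w => B * |truncKer k (z.2 - S + 1) (z - w)|)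
    (hF.mono fun m hm => (hk.integrable_conv hm z).aestronglyMeasurable)
    (hF.mono fun m hm => Eventually.of_forall fun w => ?_)
    ((hk.integrable_truncKer_sub _ z).abs.const_mul B)
    (Eventually.of_forall fun w => (hlim w).const_mul _)
  rw [← truncKer_mul hm hz, norm_mul, mul_comm, Real.norm_eq_abs, Real.norm_eq_abs]
  exact mul_le_mul_of_nonneg_right (hm.bound w) (abs_nonneg _)

/-- A causal convolution written as an iterated integral. -/
lemma IsCausalKernel.conv_eq_iterated (hk : IsCausalKernel k) (hf : IsSource S B f)
    (x : Euc n) (t : ℝ) :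
    ∫ w, k ((x, t) - w) * f w = ∫ s in Set.Ioo S t, ∫ y, k (x - y, t - s) * f (y, s) := by
  have h := hk.integrable_conv hf (x, t)
  rw [Measure.volume_eq_prod] at h ⊢
  rw [integral_prod_symm _ h]
  refine (setIntegral_eq_integral_of_forall_compl_eq_zero fun s hs => ?_).symm
  rw [Set.mem_Ioo, not_and_or, not_lt, not_lt] at hs
  refine integral_eq_zero_of_ae (Eventually.of_forall fun y => ?_)
  rcases hs with hs | hs
  · simp [hf.eq_zero (y, s) hs]
  · have h0 := hk.eq_zero (x - y, t - s) (sub_nonpos.2 hs)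
    simp [h0]

lemma IsCausalKernel.integrable_slice (hk : IsCausalKernel k) (hf : IsSource S B f)
    (x : Euc n) (t : ℝ) : ∀ᵐ s : ℝ, Integrable fun y => k (x - y, t - s) * f (y, s) := by
  have h := hk.integrable_conv hf (x, t)
  rw [Measure.volume_eq_prod] at h
  exact h.prod_left_ae

lemma IsCausalKernel.integrable_slice_integral (hk : IsCausalKernel k) (hf : IsSource S B f)
    (x : Euc n) (t : ℝ) : Integrable fun s : ℝ => ∫ y, k (x - y, t - s) * f (y, s) := by
  have h := hk.integrable_conv hf (x, t)
  rw [Measure.volume_eq_prod] at h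
  exact h.integral_prod_right

lemma IsCausalKernel.integrable_heat_conv (hk : IsCausalKernel k) (hf : IsSource S B f)
    (x : Euc n) {a : ℝ} (ha : 0 < a) (b : ℝ) :
    Integrable (fun p : Euc n × (Euc n × ℝ) =>
      heatKer n (x - p.1) a * (k ((p.1, b) - p.2) * f p.2)) (volume.prod volume) := by
  have hm : Measurable fun p : Euc n × (Euc n × ℝ) =>
      heatKer n (x - p.1) a * (k ((p.1, b) - p.2) * f p.2) := by
    refine (Measurable.heatKer (by fun_prop) (by fun_prop)).mul (Measurable.mul ?_ ?_)
    · have h := hk.measurable.comp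
        (by fun_prop : Measurable fun p : Euc n × (Euc n × ℝ) => (p.1, b) - p.2)
      exact h
    · exact hf.measurable.comp measurable_snd
  rw [integrable_prod_iff hm.aestronglyMeasurable]
  refine ⟨Eventually.of_forall fun y =>
    (hk.integrable_conv hf (y, b)).const_mul (heatKer n (x - y) a), ?_⟩
  refine ((integrable_heatKer_sub x ha).mul_const
    (B * ∫ w, |truncKer k (b - S + 1) w|)).mono'
    hm.norm.stronglyMeasurable.integral_prod_right'.aestronglyMeasurable
    (Eventually.of_forall fun y => ?_)
  simp only [norm_mul (heatKer n (x - y) a), Real.norm_of_nonneg (heatKer_nonneg (x - y) ha)]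
  rw [integral_const_mul, norm_mul, Real.norm_of_nonneg (heatKer_nonneg _ ha)]
  refine mul_le_mul_of_nonneg_left ?_ (heatKer_nonneg _ ha)
  rw [Real.norm_of_nonneg (integral_nonneg fun _ => norm_nonneg _)]
  exact hk.integral_abs_conv_le hf (z := (y, b)) (by simp only; linarith)

end Causal

lemma isCausalKernel_oseenKer {n : ℕ} (i j k : Fin n) :
    IsCausalKernel fun q : Euc n × ℝ => oseenKer n i j k q.1 q.2 where
  measurable := measurable_oseenKer i j k
  eq_zero _ hq := if_neg (not_lt.2 hq)
  integrableOn := integrableOn_oseenKer i j k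

/-- The quadratic source `u_k u_j` cut off to times in `(T, 0)`. -/
def nlSource {n : ℕ} (T : ℝ) (u : Euc n → ℝ → Euc n) (j k : Fin n) (w : Euc n × ℝ) : ℝ :=
  if T < w.2 ∧ w.2 < 0 then u w.1 w.2 k * u w.1 w.2 j else 0

/-- The Oseen kernel as a function on space-time. -/
def oseenST (n : ℕ) (i j k : Fin n) (q : Euc n × ℝ) : ℝ := oseenKer n i j k q.1 q.2

/-- The Duhamel term of the mild formulation, up to normalisation. -/
def duhamel {n : ℕ} (T : ℝ) (u : Euc n → ℝ → Euc n) (i : Fin n) (z : Euc n × ℝ) : ℝ :=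
  ∑ j, ∑ k, ∫ w, oseenST n i j k (z - w) * nlSource T u j k w

lemma isCausalKernel_oseenST {n : ℕ} (i j k : Fin n) : IsCausalKernel (oseenST n i j k) :=
  isCausalKernel_oseenKer i j k

section Mild

variable {n : ℕ} {u : Euc n → ℝ → Euc n} {C T c : ℝ}

lemma isSource_nlSource (hu : Measurable fun q : Euc n × ℝ => u q.1 q.2) (hC : 0 ≤ C)
    (hb : ∀ x, ∀ t ∈ Set.Ioo T 0, ‖u x t‖ ≤ C) (j k : Fin n) :
    IsSource T (C * C) (nlSource T u j k) where
  measurable := by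
    refine Measurable.ite ?_ ?_ measurable_const
    · exact (measurableSet_lt measurable_const measurable_snd).inter
        (measurableSet_lt measurable_snd measurable_const)
    · fun_prop
  bound w := by
    unfold nlSource
    split_ifs with h
    · rw [abs_mul]
      exact mul_le_mul ((abs_coord_le _ _).trans (hb _ _ h)) ((abs_coord_le _ _).trans (hb _ _ h))
        (abs_nonneg _) hC
    · simpa using mul_nonneg hC hC
  eq_zero w hw := if_neg fun h => absurd h.1 (not_lt.2 hw)

lemma duhamel_eq_iterated (hc : ∀ (i j k : Fin n) (x : Euc n) (t : ℝ), 0 < t →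
      Kten n i j k x t = c * oseenKer n i j k x t)
    (hu : Measurable fun q : Euc n × ℝ => u q.1 q.2) (hC : 0 ≤ C)
    (hb : ∀ x, ∀ t ∈ Set.Ioo T 0, ‖u x t‖ ≤ C) (i : Fin n) (x : Euc n) {t : ℝ} (ht : t < 0) :
    ∫ s in Set.Ioo T t, ∫ y : Euc n,
      ∑ j : Fin n, ∑ k : Fin n, Kten n i j k (x - y) (t - s) * u y s k * u y s j =
    c * duhamel T u i (x, t) := by
  have hK := fun j k => isCausalKernel_oseenST (n := n) i j k
  have hS := fun j k => isSource_nlSource hu hC hb j k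
  have hsl : ∀ᵐ s : ℝ, ∀ j k, Integrable fun y =>
      oseenST n i j k (x - y, t - s) * nlSource T u j k (y, s) :=
    ae_all_iff.2 fun j => ae_all_iff.2 fun k => (hK j k).integrable_slice (hS j k) x t
  have h1 : ∫ s in Set.Ioo T t, ∫ y : Euc n,
      ∑ j : Fin n, ∑ k : Fin n, Kten n i j k (x - y) (t - s) * u y s k * u y s j =
      ∫ s in Set.Ioo T t, ∑ j, ∑ k, c * ∫ y,
        oseenST n i j k (x - y, t - s) * nlSource T u j k (y, s) := by
    refine setIntegral_congr_ae measurableSet_Ioo ?_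
    filter_upwards [hsl] with s hs hsI
    have e : ∀ y, ∑ j : Fin n, ∑ k : Fin n, Kten n i j k (x - y) (t - s) * u y s k * u y s j =
        ∑ j, ∑ k, c * (oseenST n i j k (x - y, t - s) * nlSource T u j k (y, s)) := by
      intro y
      refine Finset.sum_congr rfl fun j _ => Finset.sum_congr rfl fun k _ => ?_
      rw [hc i j k _ _ (sub_pos.2 hsI.2), nlSource, if_pos ⟨hsI.1, hsI.2.trans ht⟩, oseenST]
      ring
    simp only [e]
    rw [integral_finsetSum _ fun j _ => integrable_finsetSum _ fun k _ => (hs j k).const_mul c]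
    refine Finset.sum_congr rfl fun j _ => ?_
    rw [integral_finsetSum _ fun k _ => (hs j k).const_mul c]
    exact Finset.sum_congr rfl fun k _ => integral_const_mul _ _
  have hi := fun j k => (((hK j k).integrable_slice_integral (hS j k) x t).const_mul c).restrict
    (s := Set.Ioo T t)
  rw [h1, integral_finsetSum _ fun j _ => integrable_finsetSum _ fun k _ => hi j k, duhamel,
    Finset.mul_sum]
  refine Finset.sum_congr rfl fun j _ => ?_
  rw [integral_finsetSum _ fun k _ => hi j k, Finset.mul_sum]
  refine Finset.sum_congr rfl fun k _ => ?_
  rw [integral_const_mul, (hK j k).conv_eq_iterated (hS j k)]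

lemma isMildNS_iff (hc : ∀ (i j k : Fin n) (x : Euc n) (t : ℝ), 0 < t →
      Kten n i j k x t = c * oseenKer n i j k x t)
    (hu : Measurable fun q : Euc n × ℝ => u q.1 q.2) (hC : 0 ≤ C)
    (hb : ∀ x, ∀ t ∈ Set.Ioo T 0, ‖u x t‖ ≤ C) (w₀ : Euc n → Euc n) :
    IsMildNS n T 0 w₀ u ↔ ∀ x, ∀ t ∈ Set.Ioo T 0, ∀ i,
      u x t i = (∫ y, heatKer n (x - y) (t - T) * w₀ y i) - c * duhamel T u i (x, t) := by
  refine forall_congr' fun x => forall_congr' fun t => forall_congr' fun ht =>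
    forall_congr' fun i => ?_
  rw [duhamel_eq_iterated hc hu hC hb i x ht.2]

lemma integrable_heatKer_mul_bdd {g : Euc n → ℝ} {B : ℝ} (hg : Measurable g)
    (hB : ∀ y, |g y| ≤ B) (x : Euc n) {a : ℝ} (ha : 0 < a) :
    Integrable fun y => heatKer n (x - y) a * g y :=
  (integrable_heatKer_sub x ha).mul_bdd hg.aestronglyMeasurable (Eventually.of_forall hB)

lemma integrable_heatKer_mul_heat {g : Euc n → ℝ} {B : ℝ} (hg : Measurable g)
    (hB : ∀ y, |g y| ≤ B) (x : Euc n) {a b : ℝ} (ha : 0 < a) (hb : 0 < b) :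
    Integrable (fun p : Euc n × Euc n => heatKer n (x - p.1) a * (heatKer n (p.1 - p.2) b * g p.2))
      (volume.prod volume) := by
  have hm1 : Measurable fun p : Euc n × Euc n => heatKer n (x - p.1) a * heatKer n (p.1 - p.2) b :=
    (Measurable.heatKer (by fun_prop) (by fun_prop)).mul
      (Measurable.heatKer (by fun_prop) (by fun_prop))
  have h1 : Integrable (fun p : Euc n × Euc n => heatKer n (x - p.1) a * heatKer n (p.1 - p.2) b)
      (volume.prod volume) := by
    rw [integrable_prod_iff hm1.aestronglyMeasurable]
    refine ⟨Eventually.of_forall fun y => (integrable_heatKer_sub y hb).const_mul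
      (heatKer n (x - y) a), ?_⟩
    refine (integrable_heatKer_sub x ha).congr (Eventually.of_forall fun y => ?_)
    simp only [norm_mul, Real.norm_of_nonneg (heatKer_nonneg _ ha),
      Real.norm_of_nonneg (heatKer_nonneg _ hb)]
    rw [integral_const_mul, integral_heatKer_sub y hb, mul_one]
  refine (h1.mul_bdd (hg.comp measurable_snd).aestronglyMeasurable
    (Eventually.of_forall fun p => hB p.2)).congr (Eventually.of_forall fun p => ?_)
  simp only [Function.comp_apply, mul_assoc]

lemma heat_semigroup {g : Euc n → ℝ} {B : ℝ} (hg : Measurable g)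
    (hB : ∀ y, |g y| ≤ B) (x : Euc n) {a b : ℝ} (ha : 0 < a) (hb : 0 < b) :
    ∫ y, heatKer n (x - y) a * ∫ z, heatKer n (y - z) b * g z =
      ∫ z, heatKer n (x - z) (a + b) * g z := by
  simp only [← integral_const_mul]
  rw [integral_integral_swap (integrable_heatKer_mul_heat hg hB x ha hb)]
  refine integral_congr_ae (Eventually.of_forall fun z => ?_)
  simp only [← mul_assoc]
  rw [integral_mul_const]
  congr 1
  rw [← integral_heatKer_mul (x - z) ha hb,
    ← integral_sub_right_eq_self (fun y => heatKer n (x - z - y) a * heatKer n y b) z]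
  refine integral_congr_ae (Eventually.of_forall fun y => ?_)
  simp only [sub_sub_sub_cancel_right]

lemma heat_conv_duhamel {f : Euc n × ℝ → ℝ} {S B : ℝ} (hf : IsSource S B f) (i j k : Fin n)
    (x : Euc n) {a : ℝ} (ha : 0 < a) (b : ℝ) :
    ∫ y, heatKer n (x - y) a * ∫ w, oseenST n i j k ((y, b) - w) * f w =
      ∫ w, oseenST n i j k ((x, a + b) - w) * (if w.2 < b then f w else 0) := by
  simp only [← integral_const_mul]
  rw [integral_integral_swap ((isCausalKernel_oseenST i j k).integrable_heat_conv hf x ha b)]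
  refine integral_congr_ae (Eventually.of_forall fun w => ?_)
  simp only [← mul_assoc]
  rw [integral_mul_const]
  simp only [oseenST, Prod.fst_sub, Prod.snd_sub]
  by_cases hw : w.2 < b
  · rw [if_pos hw, add_sub_assoc, ← heatKer_conv_oseenKer i j k ha (sub_pos.2 hw) (x - w.1),
      ← integral_sub_right_eq_self
        (fun y => heatKer n (x - w.1 - y) a * oseenKer n i j k y (b - w.2)) w.1]
    simp only [sub_sub_sub_cancel_right]
  · rw [if_neg hw, mul_zero]
    have : ∀ y : Euc n, oseenKer n i j k (y - w.1) (b - w.2) = 0 := fun y =>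
      if_neg (by linarith)
    simp [this]

/-- A mild solution restarted at a later time is a mild solution. -/
lemma IsMildNS.restart (hc : ∀ (i j k : Fin n) (x : Euc n) (t : ℝ), 0 < t →
      Kten n i j k x t = c * oseenKer n i j k x t)
    (hu : Measurable fun q : Euc n × ℝ => u q.1 q.2) (hC : 0 ≤ C)
    (hb : ∀ x, ∀ t ∈ Set.Ioo T 0, ‖u x t‖ ≤ C) {w₀ : Euc n → Euc n} (hw : Measurable w₀) {B : ℝ}
    (hB : ∀ x, ‖w₀ x‖ ≤ B) (h : IsMildNS n T 0 w₀ u) {S : ℝ} (hTS : T < S) (hS : S < 0) :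
    IsMildNS n S 0 (fun x => u x S) u := by
  have hb' : ∀ x, ∀ t ∈ Set.Ioo S 0, ‖u x t‖ ≤ C := fun x t ht => hb x t ⟨hTS.trans ht.1, ht.2⟩
  rw [isMildNS_iff hc hu hC hb] at h
  rw [isMildNS_iff hc hu hC hb']
  intro x t ht i
  have ha : 0 < t - S := sub_pos.2 ht.1
  have hb0 : 0 < S - T := sub_pos.2 hTS
  have hwm : Measurable fun y => w₀ y i := by fun_prop
  have hwB : ∀ y, |w₀ y i| ≤ B := fun y => (abs_coord_le _ _).trans (hB y)
  have hsrc := fun j k => isSource_nlSource hu hC hb j k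
  have hsrc' := fun j k => isSource_nlSource hu hC hb' j k
  have hK := fun j k => isCausalKernel_oseenST (n := n) i j k
  have hD : ∀ j k, Integrable fun y => heatKer n (x - y) (t - S) *
      ∫ w, oseenST n i j k ((y, S) - w) * nlSource T u j k w := fun j k => by
    simpa only [integral_const_mul] using
      ((hK j k).integrable_heat_conv (hsrc j k) x ha S).integral_prod_left
  have hH : Integrable fun y => heatKer n (x - y) (t - S) *
      ∫ z, heatKer n (y - z) (S - T) * w₀ z i := by
    simpa only [integral_const_mul] using
      (integrable_heatKer_mul_heat hwm hwB x ha hb0).integral_prod_left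
  have e1 : ∀ y, heatKer n (x - y) (t - S) * u y S i =
      heatKer n (x - y) (t - S) * (∫ z, heatKer n (y - z) (S - T) * w₀ z i) -
      c * ∑ j, ∑ k, heatKer n (x - y) (t - S) *
        ∫ w, oseenST n i j k ((y, S) - w) * nlSource T u j k w := fun y => by
    rw [h y S ⟨hTS, hS⟩ i, duhamel]
    simp only [← Finset.mul_sum]
    ring
  have hne : ∀ᵐ w : Euc n × ℝ, w.2 ≠ S := by
    rw [Measure.volume_eq_prod]
    exact Measure.quasiMeasurePreserving_snd.ae (Measure.ae_ne volume S)
  have e2 : ∀ j k, (∫ w, oseenST n i j k ((x, t) - w) * nlSource T u j k w) =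
      (∫ w, oseenST n i j k ((x, t - S + S) - w) * (if w.2 < S then nlSource T u j k w else 0)) +
      ∫ w, oseenST n i j k ((x, t) - w) * nlSource S u j k w := fun j k => by
    have hcut : IsSource T (C * C) fun w => if w.2 < S then nlSource T u j k w else 0 :=
      { measurable := Measurable.ite (measurableSet_lt measurable_snd measurable_const)
          (hsrc j k).measurable measurable_const
        bound := fun w => by
          split_ifs
          · exact (hsrc j k).bound w
          · simpa using mul_nonneg hC hC
        eq_zero := fun w hw => by simp only [(hsrc j k).eq_zero w hw, ite_self] }
    rw [sub_add_cancel, ← integral_add ((hK j k).integrable_conv hcut _)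
      ((hK j k).integrable_conv (hsrc' j k) _)]
    refine integral_congr_ae (hne.mono fun w hw => ?_)
    simp only [← mul_add]
    congr 1
    rcases lt_or_gt_of_ne hw with h1 | h1
    · simp [nlSource, h1, not_lt.2 h1.le]
    · simp [nlSource, h1, not_lt.2 h1.le, hTS.trans h1]
  rw [h x t ⟨hTS.trans ht.1, ht.2⟩ i]
  simp only [e1]
  rw [integral_sub hH (by
      exact (integrable_finsetSum _ fun j _ => integrable_finsetSum _ fun k _ => hD j k).const_mul c),
    heat_semigroup hwm hwB x ha hb0, integral_const_mul,
    integral_finsetSum _ fun j _ => integrable_finsetSum _ fun k _ => hD j k, sub_add_sub_cancel]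
  simp only [duhamel, e2, Finset.sum_add_distrib, integral_finsetSum _ fun k _ => hD _ k]
  simp only [fun j k => heat_conv_duhamel (hsrc j k) i j k x ha S]
  ring

end Mild

lemma heatKer_le_of_near {n : ℕ} {z z' : Euc n} {τ τ' : ℝ} (hτ : 0 < τ) (h1 : τ / 2 ≤ τ')
    (h2 : τ' ≤ 2 * τ) (hz : ‖z - z'‖ ≤ 1) :
    heatKer n z' τ' ≤ ((4 * π * (τ / 2)) ^ (-(n : ℝ) / 2) * Real.exp (1 / (8 * τ)) *
      (4 * π * (4 * τ)) ^ ((n : ℝ) / 2)) * heatKer n z (4 * τ) := by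
  have hτ' : 0 < τ' := by linarith
  have e : (4 * π * (4 * τ)) ^ ((n : ℝ) / 2) * (4 * π * (4 * τ)) ^ (-(n : ℝ) / 2) = 1 := by
    rw [← rpow_add (by positivity)]; ring_nf; exact rpow_zero _
  have hexp : Real.exp (-‖z'‖ ^ 2 / (4 * τ')) ≤
      Real.exp (1 / (8 * τ)) * Real.exp (-‖z‖ ^ 2 / (4 * (4 * τ))) := by
    rw [← Real.exp_add, Real.exp_le_exp]
    have hn : ‖z‖ ≤ ‖z'‖ + 1 := by
      have := norm_add_le (z - z') z'
      rw [sub_add_cancel] at this; linarith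
    have hq : ‖z‖ ^ 2 ≤ 2 * ‖z'‖ ^ 2 + 2 := by
      nlinarith [norm_nonneg z, norm_nonneg z', sq_nonneg (‖z'‖ - 1)]
    have h3 : -‖z'‖ ^ 2 / (4 * τ') ≤ -‖z'‖ ^ 2 / (8 * τ) := by
      rw [neg_div, neg_div, neg_le_neg_iff]
      exact div_le_div_of_nonneg_left (by positivity) (by positivity) (by linarith)
    refine h3.trans ?_
    have : 1 / (8 * τ) + -‖z‖ ^ 2 / (4 * (4 * τ)) - -‖z'‖ ^ 2 / (8 * τ) =
        (2 + 2 * ‖z'‖ ^ 2 - ‖z‖ ^ 2) / (16 * τ) := by field_simp; ring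
    have h4 : 0 ≤ (2 + 2 * ‖z'‖ ^ 2 - ‖z‖ ^ 2) / (16 * τ) := by
      apply div_nonneg <;> [linarith; positivity]
    linarith
  have hpow : (4 * π * τ') ^ (-(n : ℝ) / 2) ≤ (4 * π * (τ / 2)) ^ (-(n : ℝ) / 2) :=
    rpow_le_rpow_of_nonpos (by positivity) (by gcongr)
      (by rw [neg_div, neg_nonpos]; positivity)
  unfold heatKer
  calc _ ≤ (4 * π * (τ / 2)) ^ (-(n : ℝ) / 2) *
        (Real.exp (1 / (8 * τ)) * Real.exp (-‖z‖ ^ 2 / (4 * (4 * τ)))) := by gcongr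
    _ = (4 * π * (τ / 2)) ^ (-(n : ℝ) / 2) * Real.exp (1 / (8 * τ)) *
        ((4 * π * (4 * τ)) ^ ((n : ℝ) / 2) * (4 * π * (4 * τ)) ^ (-(n : ℝ) / 2)) *
        Real.exp (-‖z‖ ^ 2 / (4 * (4 * τ))) := by rw [e]; ring
    _ = _ := by ring

lemma tendsto_integral_abs_heatKer_sub {n : ℕ} (x : Euc n) {τ : ℝ} (hτ : 0 < τ) :
    Tendsto (fun q : Euc n × ℝ => ∫ y, |heatKer n (q.1 - y) q.2 - heatKer n (x - y) τ|)
      (𝓝 (x, τ)) (𝓝 0) := by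
  have h := tendsto_integral_filter_of_dominated_convergence (μ := (volume : Measure (Euc n)))
    (F := fun (q : Euc n × ℝ) y => |heatKer n (q.1 - y) q.2 - heatKer n (x - y) τ|)
    (f := fun _ => 0) (l := 𝓝 (x, τ))
    (fun y => ((4 * π * (τ / 2)) ^ (-(n : ℝ) / 2) * Real.exp (1 / (8 * τ)) *
      (4 * π * (4 * τ)) ^ ((n : ℝ) / 2)) * heatKer n (x - y) (4 * τ) + heatKer n (x - y) τ)
    (Eventually.of_forall fun q => by
      have h1 : Measurable fun y : Euc n => heatKer n (q.1 - y) q.2 :=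
        Measurable.heatKer (by fun_prop) (by fun_prop)
      have h2 : Measurable fun y : Euc n => heatKer n (x - y) τ :=
        Measurable.heatKer (by fun_prop) (by fun_prop)
      exact (h1.sub h2).abs.aestronglyMeasurable)
    (by
      have hnear : ∀ᶠ q : Euc n × ℝ in 𝓝 (x, τ), q.1 ∈ Metric.ball x 1 ∧
          q.2 ∈ Set.Ioo (τ / 2) (2 * τ) := by
        rw [nhds_prod_eq]
        exact prod_mem_prod (Metric.ball_mem_nhds x one_pos)
          (Ioo_mem_nhds (by linarith) (by linarith))
      filter_upwards [hnear] with q hq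
      refine Eventually.of_forall fun y => ?_
      have hq2 : 0 < q.2 := by linarith [hq.2.1]
      rw [Real.norm_of_nonneg (abs_nonneg _)]
      refine (abs_sub _ _).trans ?_
      rw [abs_of_nonneg (heatKer_nonneg _ hq2), abs_of_nonneg (heatKer_nonneg _ hτ)]
      gcongr
      refine heatKer_le_of_near hτ hq.2.1.le hq.2.2.le ?_
      have := hq.1
      rw [Metric.mem_ball, dist_eq_norm'] at this
      simpa using this.le)
    (((integrable_heatKer_sub x (by positivity)).const_mul _).add (integrable_heatKer_sub x hτ))
    (Eventually.of_forall fun y => by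
      have hc : ContinuousAt (fun q : Euc n × ℝ => heatKer n (q.1 - y) q.2) (x, τ) := by
        unfold heatKer
        refine ContinuousAt.mul (ContinuousAt.rpow_const (by fun_prop) (Or.inl ?_))
          (ContinuousAt.rexp (ContinuousAt.div (by fun_prop) (by fun_prop) ?_))
        · simp only; positivity
        · simp only; positivity
      have h0 := (hc.tendsto.sub_const (heatKer n (x - y) τ)).abs
      simpa using h0)
  simpa using h

/-- A bounded, asymptotically equicontinuous sequence has a locally uniformly convergent
subsequence. -/
lemma exists_subseq_tendstoLocallyUniformlyOn {E F : Type*} [PseudoMetricSpace E]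
    [TopologicalSpace.SeparableSpace E] [Nonempty E] [NormedAddCommGroup F] [ProperSpace F]
    {U : Set E} (hU : IsOpen U) {C : ℝ} (f : ℕ → E → F)
    (hb : ∀ p ∈ U, ∀ᶠ m in atTop, ‖f m p‖ ≤ C)
    (heq : ∀ p ∈ U, ∀ ε > 0, ∃ δ > 0, ∀ᶠ m in atTop, ∀ q, dist q p < δ → ‖f m q - f m p‖ ≤ ε) :
    ∃ φ : ℕ → ℕ, StrictMono φ ∧ ∃ g : E → F,
      TendstoLocallyUniformlyOn (fun m => f (φ m)) g atTop U := by
  classical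
  let d := TopologicalSpace.denseSeq E
  let a : ℕ → ℕ → F := fun m k => if ‖f m (d k)‖ ≤ C then f m (d k) else 0
  have ha : ∀ m, a m ∈ Set.univ.pi fun _ : ℕ => Metric.closedBall (0 : F) |C| := fun m k _ => by
    simp only [a, mem_closedBall_zero_iff]
    split_ifs with h
    · exact h.trans (le_abs_self C)
    · simp
  obtain ⟨b, -, φ, hφ, hlim⟩ :=
    (isCompact_univ_pi fun _ => isCompact_closedBall (0 : F) |C|).tendsto_subseq ha
  rw [tendsto_pi_nhds] at hlim
  have hcau : ∀ p ∈ U, CauchySeq fun m => f (φ m) p := fun p hp => by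
    rw [Metric.cauchySeq_iff']
    intro ε hε
    obtain ⟨δ, hδ, hN⟩ := heq p hp (ε / 8) (by positivity)
    obtain ⟨k, hk⟩ := (TopologicalSpace.denseRange_denseSeq E).exists_mem_open
      (hU.inter Metric.isOpen_ball) ⟨p, hp, Metric.mem_ball_self hδ⟩
    obtain ⟨N, hN'⟩ := eventually_atTop.1 ((hφ.tendsto_atTop.eventually hN).and
      ((hφ.tendsto_atTop.eventually (hb (d k) hk.1)).and
        ((Metric.tendsto_nhds.1 (hlim k)) (ε / 8) (by positivity))))
    have key : ∀ m ≥ N, dist (f (φ m) p) (b k) < ε / 4 := fun m hm => by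
      obtain ⟨h1, h2, h3⟩ := hN' m hm
      have h4 := h1 (d k) hk.2
      simp only [Function.comp_apply, a, if_pos h2] at h3
      rw [← dist_eq_norm, dist_comm] at h4
      linarith [dist_triangle (f (φ m) p) (f (φ m) (d k)) (b k)]
    exact ⟨N, fun m hm => by
      linarith [key m hm, key N le_rfl, dist_triangle_right (f (φ m) p) (f (φ N) p) (b k)]⟩
  choose! g hg using fun p hp => cauchySeq_tendsto_of_complete (hcau p hp)
  refine ⟨φ, hφ, g, ?_⟩
  rw [Metric.tendstoLocallyUniformlyOn_iff]
  intro ε hε p hp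
  obtain ⟨δ, hδ, hN⟩ := heq p hp (ε / 4) (by positivity)
  refine ⟨U ∩ Metric.ball p δ, inter_mem self_mem_nhdsWithin
    (mem_nhdsWithin_of_mem_nhds (Metric.ball_mem_nhds p hδ)), ?_⟩
  have hN' := hφ.tendsto_atTop.eventually hN
  filter_upwards [hN', Metric.tendsto_nhds.1 (hg p hp) (ε / 4) (by positivity)] with m hm hmp q hq
  have h1 : dist (g q) (g p) ≤ ε / 4 := by
    refine le_of_tendsto ((hg q hq.1).dist (hg p hp)) (hN'.mono fun m hm => ?_)
    rw [dist_eq_norm]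
    exact hm q hq.2
  have h2 := hm q hq.2
  rw [← dist_eq_norm] at h2
  rw [dist_comm] at h2 hmp
  have h3 := dist_triangle4 (g q) (g p) (f (φ m) p) (f (φ m) q)
  linarith

lemma norm_le_sum_abs {n : ℕ} (v : Euc n) : ‖v‖ ≤ ∑ i, |v i| := by
  rw [EuclideanSpace.norm_eq]
  refine Real.sqrt_le_iff.2 ⟨Finset.sum_nonneg fun i _ => abs_nonneg _, ?_⟩
  simp only [Real.norm_eq_abs]
  exact Finset.sum_sq_le_sq_sum_of_nonneg fun i _ => abs_nonneg _

lemma equicontinuous_mild {n : ℕ} {c C : ℝ} {T : ℕ → ℝ} {u : ℕ → Euc n → ℝ → Euc n}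
    (hc : ∀ (i j k : Fin n) (x : Euc n) (t : ℝ), 0 < t →
      Kten n i j k x t = c * oseenKer n i j k x t)
    (hTbot : Tendsto T atTop atBot)
    (hmeas : ∀ l, Measurable fun q : Euc n × ℝ => u l q.1 q.2) (hC : 0 ≤ C)
    (hbd : ∀ l, ∀ x, ∀ t ∈ Set.Ioo (T l) 0, ‖u l x t‖ ≤ C)
    (hres : ∀ l S, T l < S → S < 0 → IsMildNS n S 0 (fun x => u l x S) (u l))
    (p : Euc n × ℝ) (hp : p.2 < 0) (ε : ℝ) (hε : 0 < ε) :
    ∃ δ > 0, ∀ᶠ m in atTop, ∀ q : Euc n × ℝ, dist q p < δ →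
      ‖u m q.1 q.2 - u m p.1 p.2‖ ≤ ε := by
  set S := p.2 - 1 with hS
  let ω : Euc n × ℝ → ℝ := fun q => ∑ i : Fin n,
    (C * (∫ y, |heatKer n (q.1 - y) (q.2 - S) - heatKer n (p.1 - y) (p.2 - S)|) +
      |c| * ∑ j, ∑ k, C * C * ∫ w,
        |truncKer (oseenST n i j k) 2 (q - w) - truncKer (oseenST n i j k) 2 (p - w)|)
  have hheat : Tendsto (fun q : Euc n × ℝ =>
      ∫ y, |heatKer n (q.1 - y) (q.2 - S) - heatKer n (p.1 - y) (p.2 - S)|) (𝓝 p) (𝓝 0) := by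
    have hsh : Tendsto (fun q : Euc n × ℝ => (q.1, q.2 - S)) (𝓝 p) (𝓝 (p.1, p.2 - S)) :=
      Continuous.tendsto (by fun_prop) p
    have h := (tendsto_integral_abs_heatKer_sub p.1 (by linarith : 0 < p.2 - S)).comp hsh
    exact h
  have hω : Tendsto ω (𝓝 p) (𝓝 0) := by
    have hk : ∀ i j k, Tendsto (fun q => ∫ w,
        |truncKer (oseenST n i j k) 2 (q - w) - truncKer (oseenST n i j k) 2 (p - w)|)
        (𝓝 p) (𝓝 0) := fun i j k => tendsto_integral_abs_sub_translate
          ((isCausalKernel_oseenST i j k).integrable_truncKer 2) p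
    have h : Tendsto ω (𝓝 p) (𝓝 (∑ _i : Fin n,
        (C * 0 + |c| * ∑ _j : Fin n, ∑ _k : Fin n, C * C * 0))) :=
      tendsto_finsetSum _ fun i _ => (hheat.const_mul C).add
        ((tendsto_finsetSum _ fun j _ => tendsto_finsetSum _ fun k _ =>
          (hk i j k).const_mul (C * C)).const_mul |c|)
    simpa using h
  have hnear : ∀ᶠ q in 𝓝 p, ω q < ε ∧ q.2 ∈ Set.Ioo S (min 0 (p.2 + 1)) :=
    (hω.eventually (gt_mem_nhds hε)).and (continuous_snd.tendsto p
      (Ioo_mem_nhds (by linarith) (lt_min hp (by linarith))))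
  obtain ⟨δ, hδ, hball⟩ := Metric.eventually_nhds_iff.1 hnear
  refine ⟨δ, hδ, (hTbot.eventually (eventually_lt_atBot S)).mono fun m hm q hq => ?_⟩
  obtain ⟨hωq, hq1, hq2⟩ := hball hq
  have hS0 : S < 0 := by linarith
  have hb' : ∀ x, ∀ t ∈ Set.Ioo S 0, ‖u m x t‖ ≤ C := fun x t ht =>
    hbd m x t ⟨hm.trans ht.1, ht.2⟩
  have hmild := (isMildNS_iff hc (hmeas m) hC hb' _).1 (hres m S hm hS0)
  have hqt : q.2 ∈ Set.Ioo S 0 := ⟨hq1, hq2.trans_le (min_le_left _ _)⟩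
  have hpt : p.2 ∈ Set.Ioo S 0 := ⟨by linarith, hp⟩
  have hq3 : q.2 < S + 2 := by linarith [hq2.trans_le (min_le_right 0 (p.2 + 1))]
  have hp3 : p.2 < S + 2 := by linarith
  refine (norm_le_sum_abs _).trans (le_trans (Finset.sum_le_sum fun i _ => ?_) hωq.le)
  have hgm : Measurable fun y => u m y S i := by
    have h := (hmeas m).comp (measurable_id.prodMk (measurable_const (a := S)))
    have h' : Measurable fun y => u m y S := h
    fun_prop
  have hgB : ∀ y, |u m y S i| ≤ C := fun y => (abs_coord_le _ _).trans (hbd m y S ⟨hm, hS0⟩)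
  have ha : 0 < q.2 - S := sub_pos.2 hq1
  have hb : 0 < p.2 - S := by linarith
  rw [PiLp.sub_apply, hmild q.1 q.2 hqt i, hmild p.1 p.2 hpt i]
  have h1 : |(∫ y, heatKer n (q.1 - y) (q.2 - S) * u m y S i) -
      ∫ y, heatKer n (p.1 - y) (p.2 - S) * u m y S i| ≤
      C * ∫ y, |heatKer n (q.1 - y) (q.2 - S) - heatKer n (p.1 - y) (p.2 - S)| := by
    rw [← integral_sub (integrable_heatKer_mul_bdd hgm hgB _ ha)
      (integrable_heatKer_mul_bdd hgm hgB _ hb), ← integral_const_mul]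
    refine abs_integral_le_integral_abs.trans (integral_mono
      ((integrable_heatKer_mul_bdd hgm hgB _ ha).sub
        (integrable_heatKer_mul_bdd hgm hgB _ hb)).abs
      (((integrable_heatKer_sub _ ha).sub (integrable_heatKer_sub _ hb)).abs.const_mul C)
      fun y => ?_)
    simp only
    rw [← sub_mul, abs_mul, mul_comm]
    exact mul_le_mul_of_nonneg_right (hgB y) (abs_nonneg _)
  have h2 : |duhamel S (u m) i q - duhamel S (u m) i p| ≤ ∑ j, ∑ k, C * C * ∫ w,
        |truncKer (oseenST n i j k) 2 (q - w) - truncKer (oseenST n i j k) 2 (p - w)| := by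
    simp only [duhamel, ← Finset.sum_sub_distrib]
    refine (Finset.abs_sum_le_sum_abs _ _).trans (Finset.sum_le_sum fun j _ =>
      (Finset.abs_sum_le_sum_abs _ _).trans (Finset.sum_le_sum fun k _ => ?_))
    exact (isCausalKernel_oseenST i j k).abs_conv_sub_le
      (isSource_nlSource (hmeas m) hC hb' j k) hp3 hq3
  rw [sub_sub_sub_comm, ← mul_sub]
  refine (abs_sub _ _).trans (add_le_add h1 ?_)
  rw [abs_mul]
  exact mul_le_mul_of_nonneg_left h2 (abs_nonneg c)

/-- Pointwise limits of uniformly bounded mild solutions are mild solutions. -/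
lemma isMildNS_of_tendsto {n : ℕ} {c C S : ℝ} {u : ℕ → Euc n → ℝ → Euc n}
    {v : Euc n → ℝ → Euc n}
    (hc : ∀ (i j k : Fin n) (x : Euc n) (t : ℝ), 0 < t →
      Kten n i j k x t = c * oseenKer n i j k x t)
    (hmeas : ∀ l, Measurable fun q : Euc n × ℝ => u l q.1 q.2)
    (hv : Measurable fun q : Euc n × ℝ => v q.1 q.2) (hC : 0 ≤ C)
    (hbd : ∀ᶠ l in atTop, ∀ x, ∀ t ∈ Set.Ico S 0, ‖u l x t‖ ≤ C)
    (hvb : ∀ x, ∀ t ∈ Set.Ioo S 0, ‖v x t‖ ≤ C)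
    (hmild : ∀ᶠ l in atTop, IsMildNS n S 0 (fun x => u l x S) (u l))
    (hlim : ∀ x, ∀ t < 0, Tendsto (fun l => u l x t) atTop (𝓝 (v x t))) (hS : S < 0) :
    IsMildNS n S 0 (fun x => v x S) v := by
  rw [isMildNS_iff hc hv hC hvb]
  intro x t ht i
  have hlim' : ∀ x, ∀ t < 0, ∀ i, Tendsto (fun l => u l x t i) atTop (𝓝 (v x t i)) :=
    fun x t ht i => ((by fun_prop : Continuous fun w : Euc n => w i).tendsto _).comp (hlim x t ht)
  have hbd' : ∀ᶠ l in atTop, ∀ x, ∀ t ∈ Set.Ioo S 0, ‖u l x t‖ ≤ C :=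
    hbd.mono fun l hl x t ht => hl x t ⟨ht.1.le, ht.2⟩
  have ha : 0 < t - S := sub_pos.2 ht.1
  have h1 : Tendsto (fun l => ∫ y, heatKer n (x - y) (t - S) * u l y S i) atTop
      (𝓝 (∫ y, heatKer n (x - y) (t - S) * v y S i)) := by
    refine tendsto_integral_filter_of_dominated_convergence
      (fun y => C * heatKer n (x - y) (t - S)) (Eventually.of_forall fun l => ?_)
      (hbd.mono fun l hl => Eventually.of_forall fun y => ?_)
      ((integrable_heatKer_sub x ha).const_mul C)
      (Eventually.of_forall fun y => (hlim' y S hS i).const_mul _)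
    · have h := (hmeas l).comp (measurable_id.prodMk (measurable_const (a := S)))
      have h' : Measurable fun y => u l y S := h
      have hk : Measurable fun y : Euc n => heatKer n (x - y) (t - S) :=
        Measurable.heatKer (by fun_prop) (by fun_prop)
      exact (hk.mul (by fun_prop)).aestronglyMeasurable
    · rw [norm_mul, Real.norm_of_nonneg (heatKer_nonneg _ ha), mul_comm]
      exact mul_le_mul_of_nonneg_right
        ((abs_coord_le _ _).trans (hl y S ⟨le_rfl, hS⟩)) (heatKer_nonneg _ ha)
  have h2 : Tendsto (fun l => duhamel S (u l) i (x, t)) atTop (𝓝 (duhamel S v i (x, t))) := by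
    refine tendsto_finsetSum _ fun j _ => tendsto_finsetSum _ fun k _ => ?_
    refine (isCausalKernel_oseenST i j k).tendsto_conv
      (hbd'.mono fun l hl => isSource_nlSource (hmeas l) hC hl j k) _ fun w => ?_
    unfold nlSource
    split_ifs with hw
    · exact (hlim' _ _ hw.2 k).mul (hlim' _ _ hw.2 j)
    · exact tendsto_const_nhds
  refine tendsto_nhds_unique (hlim' x t ht.2 i) ((h1.sub (h2.const_mul c)).congr' ?_)
  filter_upwards [hbd', hmild] with l hl hm
  exact ((isMildNS_iff hc (hmeas l) hC hl _).1 hm x t ht i).symm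

/-- Lemma 6.1: a sequence of mild solutions on ℝⁿ × (T_l,0), T_l ↘ -∞, with a uniform
bound |u_l| ≤ C, has a subsequence converging locally uniformly in ℝⁿ × (-∞,0) to an
ancient mild solution u with |u| ≤ C. -/
theorem ancient_mild_limit (n : ℕ) (hn : 2 ≤ n) (C : ℝ)
    (T : ℕ → ℝ) (hTanti : Antitone T) (hTneg : ∀ l, T l < 0)
    (hTbot : Tendsto T atTop atBot)
    (u : ℕ → Euc n → ℝ → Euc n)
    (hmeas : ∀ l, Measurable (fun q : Euc n × ℝ => u l q.1 q.2))
    -- each u_l is a mild solution on ℝⁿ × (T_l,0) for some bounded initial datum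
    (hmild : ∀ l, ∃ w₀ : Euc n → Euc n, Measurable w₀ ∧ (∃ B : ℝ, ∀ x, ‖w₀ x‖ ≤ B) ∧
      IsMildNS n (T l) 0 w₀ (u l))
    (hbd : ∀ l, ∀ x : Euc n, ∀ t ∈ Set.Ioo (T l) 0, ‖u l x t‖ ≤ C) :
    ∃ φ : ℕ → ℕ, StrictMono φ ∧ ∃ v : Euc n → ℝ → Euc n,
      IsAncientMild n v ∧ (∀ x : Euc n, ∀ t < (0:ℝ), ‖v x t‖ ≤ C) ∧
      TendstoLocallyUniformlyOn (fun m (q : Euc n × ℝ) => u (φ m) q.1 q.2)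
        (fun q => v q.1 q.2) atTop (Set.univ ×ˢ Set.Iio 0) := by
  obtain ⟨c, hc⟩ := exists_Kten_eq n hn
  have hC : 0 ≤ C := (norm_nonneg _).trans
    (hbd 0 0 (T 0 / 2) ⟨by linarith [hTneg 0], by linarith [hTneg 0]⟩)
  have hres : ∀ l S, T l < S → S < 0 → IsMildNS n S 0 (fun x => u l x S) (u l) := by
    intro l S hS hS0
    obtain ⟨w₀, hw, ⟨B, hB⟩, hm⟩ := hmild l
    exact hm.restart hc (hmeas l) hC (hbd l) hw hB hS hS0
  obtain ⟨φ, hφ, g, hg⟩ := exists_subseq_tendstoLocallyUniformlyOn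
    (isOpen_univ.prod isOpen_Iio : IsOpen (Set.univ ×ˢ Set.Iio 0 : Set (Euc n × ℝ)))
    (C := C) (fun m q => u m q.1 q.2)
    (fun p hp => (hTbot.eventually (eventually_lt_atBot p.2)).mono fun m hm =>
      hbd m p.1 p.2 ⟨hm, hp.2⟩)
    (fun p hp ε hε => equicontinuous_mild hc hTbot hmeas hC hbd hres p hp.2 ε hε)
  have hTφ : Tendsto (fun m => T (φ m)) atTop atBot := hTbot.comp hφ.tendsto_atTop
  let v : Euc n → ℝ → Euc n := fun x t => if t < 0 then g (x, t) else 0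
  have hlim : ∀ x, ∀ t < 0, Tendsto (fun m => u (φ m) x t) atTop (𝓝 (v x t)) := fun x t ht => by
    simpa only [v, if_pos ht] using hg.tendsto_at (Set.mk_mem_prod (Set.mem_univ x) ht)
  have hvb : ∀ x : Euc n, ∀ t < (0 : ℝ), ‖v x t‖ ≤ C := fun x t ht =>
    le_of_tendsto (hlim x t ht).norm ((hTφ.eventually (eventually_lt_atBot t)).mono fun m hm =>
      hbd (φ m) x t ⟨hm, ht⟩)
  have hvm : Measurable fun q : Euc n × ℝ => v q.1 q.2 := by
    refine measurable_of_tendsto_metrizable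
      (f := fun m q => if q.2 < 0 then u (φ m) q.1 q.2 else 0) (fun m => Measurable.ite
        (measurableSet_lt measurable_snd measurable_const) (hmeas (φ m)) measurable_const) ?_
    rw [tendsto_pi_nhds]
    intro q
    by_cases hq : q.2 < 0
    · simpa only [if_pos hq] using hlim q.1 q.2 hq
    · simp only [v, if_neg hq, tendsto_const_nhds]
  refine ⟨φ, hφ, v, ⟨hvm, ⟨C, hvb⟩, fun l => -((l : ℝ) + 1), ?_, fun l => ?_⟩, hvb, ?_⟩
  · exact tendsto_neg_atTop_atBot.comp
      (tendsto_atTop_add_const_right _ _ tendsto_natCast_atTop_atTop)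
  · have hS : -((l : ℝ) + 1) < 0 := by
      have : (0 : ℝ) ≤ l := l.cast_nonneg
      linarith
    have hev := hTφ.eventually (eventually_lt_atBot (-((l : ℝ) + 1)))
    exact ⟨hS, isMildNS_of_tendsto hc (fun m => hmeas (φ m)) hvm hC
      (hev.mono fun m hm x t ht => hbd (φ m) x t ⟨hm.trans_le ht.1, ht.2⟩)
      (fun x t ht => hvb x t ht.2) (hev.mono fun m hm => hres (φ m) _ hm hS) hlim hS⟩
  · exact hg.congr_right fun q hq => by simp only [v, if_pos (show q.2 < 0 from hq.2)]

end
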